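/- Let O be a W-orbit in ℝ^r and t ∈ T_O. Then: (1) for the simple affine roots a_0 := (−2ε_1, 1), a_i := (ε_i − ε_{i+1}, 0) (1 ≤ i < r) and a_r := (2ε_r, 0), one has G_t^O(a_j) = s_{a_j,t} ∘ T_j^O as operators on F[O], for j = 0, 1, …, r; (2) for every g ∈ W and every affine root a ∈ Φ, G_t^O(ga) = g_t ∘ G_t^O(a) ∘ (g_t)^{−1}, where g_t denotes the twisted action of g on F[O]. -/

import Mathlib

open scoped Classical

noncomputable section

namespace QP

/-! ### The space of quasi-polynomials -/

/-- Euclidean space `ℝ^r`. -/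
abbrev E (r : ℕ) := Fin r → ℝ

variable (F : Type*) [Field F] [CharZero F] (r : ℕ)

/-- The algebra of quasi-polynomials `F[ℝ^r]`: the group algebra of `(ℝ^r,+)` over `F`. -/
abbrev QA := AddMonoidAlgebra F (E r)

/-- The quasi-monomial `x^y`. -/
def X (y : E r) : QA F r := AddMonoidAlgebra.single y 1

/-- The `i`-th coordinate of a vector (`1`-based). -/
def cd (y : E r) (i : ℕ) : ℝ := ∑ m : Fin r, if (m : ℕ) + 1 = i then y m else 0

/-- The standard basis vector `ε_i` (`1`-based). -/
def epsV (i : ℕ) : E r := fun m => if (m : ℕ) + 1 = i then 1 else 0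

/-- The standard basis vector (`0`-based). -/
def eV (m : Fin r) : E r := fun n => if n = m then 1 else 0

/-- The Euclidean inner product on `ℝ^r`. -/
def ip (v y : E r) : ℝ := ∑ m : Fin r, v m * y m

/-- An integral vector regarded as an element of `ℝ^r`. -/
def zc (lam : Fin r → ℤ) : E r := fun m => (lam m : ℝ)

/-- The simple reflections of the hyperoctahedral group `W₀ = S_r ⋉ (±1)^r` (`1`-based):
for `1 ≤ i < r`, `sW i` interchanges the `i`-th and `(i+1)`-st coordinates, and
`sW r` negates the last coordinate. -/
def sW (i : ℕ) (y : E r) : E r := fun m =>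
  if i = r then (if (m : ℕ) + 1 = r then -y m else y m)
  else if (m : ℕ) + 1 = i then cd r y (i + 1)
  else if (m : ℕ) = i then cd r y i
  else y m

/-- `s_{ε₁} = s₁⋯s_{r-1} s_r s_{r-1}⋯s₁`: negation of the first coordinate. -/
def sEps1 (y : E r) : E r := fun m => if (m : ℕ) = 0 then -y m else y m

/-- The affine simple reflection `s₀ = τ(ε₁) s_{ε₁} : y ↦ (1 - y₁, y₂, …, y_r)`, together
with `genF j = sW j` for `1 ≤ j ≤ r`: the Coxeter generators of the affine Weyl group
`W = W₀ ⋉ ℤ^r`. -/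
def genF (j : ℕ) (y : E r) : E r :=
  if j = 0 then fun m => if (m : ℕ) = 0 then 1 - y m else y m
  else sW r j y

/-- The action of the word `s_{j₁} ⋯ s_{j_ℓ}` on `ℝ^r`. -/
def wordAct (l : List ℕ) (y : E r) : E r := l.foldr (genF r) y

/-- The closure of the fundamental alcove
`C₊ = {y : 0 < y_r < ⋯ < y₁ < 1/2}`. -/
def CplusCl : Set (E r) :=
  {y | (∀ i j : Fin r, i ≤ j → y j ≤ y i) ∧ ∀ m : Fin r, 0 ≤ y m ∧ y m ≤ 1 / 2}

/-- The `W`-orbit of a point of `ℝ^r`. -/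
def orbit (y : E r) : Set (E r) :=
  {z | ∃ l : List ℕ, (∀ a ∈ l, a ≤ r) ∧ wordAct r l y = z}

/-- `O` is a `W`-orbit in `ℝ^r`. -/
def IsOrbit (O : Set (E r)) : Prop := ∃ y, O = orbit r y

/-- `c^𝒪`: the unique point of the orbit `O` lying in the closed fundamental alcove. -/
def cpt (O : Set (E r)) : E r :=
  if h : ∃ c, c ∈ O ∧ c ∈ CplusCl r then h.choose else 0

/-- The length of an element of the affine Weyl group `W` (as a map on `ℝ^r`). -/
def wlen (g : E r → E r) : ℕ :=
  sInf {n | ∃ l : List ℕ, (∀ a ∈ l, a ≤ r) ∧ l.length = n ∧ (fun y => wordAct r l y) = g}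

/-- A choice of a shortest word `l` whose inverse maps `y` into the closed alcove;
the corresponding element of `W` is `g_y`. -/
def gW (y : E r) : List ℕ :=
  if h : ∃ l : List ℕ, (∀ a ∈ l, a ≤ r) ∧ wordAct r l.reverse y ∈ CplusCl r ∧
      ∀ l' : List ℕ, (∀ a ∈ l', a ≤ r) → wordAct r l'.reverse y ∈ CplusCl r →
        l.length ≤ l'.length
  then h.choose else []

/-- `g_y`, the unique shortest element of `W` with `g_y⁻¹ y` in the closed alcove. -/
def gfun (y : E r) : E r → E r := fun z => wordAct r (gW r y) z

/-- The Bruhat order on `(W, {s₀,…,s_r})`, via the subword characterisation. -/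
def bruhatLE (u v : E r → E r) : Prop :=
  ∃ l : List ℕ, (∀ a ∈ l, a ≤ r) ∧ (fun z => wordAct r l z) = v ∧ l.length = wlen r v ∧
    ∃ l' : List ℕ, l'.Sublist l ∧ (fun z => wordAct r l' z) = u ∧ l'.length = wlen r u

/-- The partial order on `ℝ^r`: `y' ≤ y` iff `y'` and `y` lie in the same `W`-orbit and
`g_{y'} ≤_B g_y` in the Bruhat order. -/
def qle (y' y : E r) : Prop :=
  (∃ l : List ℕ, (∀ a ∈ l, a ≤ r) ∧ wordAct r l y = y') ∧ bruhatLE r (gfun r y') (gfun r y)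

/-- Strict version of `qle`. -/
def qlt (y' y : E r) : Prop := qle r y' y ∧ y' ≠ y

/-- The `F`-linear operator on `F[ℝ^r]` determined by its values on the quasi-monomials. -/
def mkOp (Ψ : E r → QA F r) : Module.End F (QA F r) :=
  Finsupp.linearCombination F Ψ ∘ₗ (AddMonoidAlgebra.coeffLinearEquiv F).toLinearMap

/-- `F[O] = span_F {x^y : y ∈ O}`. -/
def FO (O : Set (E r)) : Submodule F (QA F r) :=
  Submodule.span F {p | ∃ y ∈ O, p = X F r y}

/-- The Laurent polynomial subalgebra `F[ℤ^r] = span_F {x^μ : μ ∈ ℤ^r}`. -/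
def Lspan : Submodule F (QA F r) :=
  Submodule.span F {p | ∃ lam : Fin r → ℤ, p = X F r (zc r lam)}

/-- `span_F {x^{y'} : y' < y}`. -/
def ltSpan (y : E r) : Submodule F (QA F r) :=
  Submodule.span F {p | ∃ y', qlt r y' y ∧ p = X F r y'}

/-! ### Floors and indicator/sign functions -/

/-- the largest even integer `≤ z` -/
def floorE (z : ℝ) : ℤ := 2 * ⌊z / 2⌋
/-- the largest odd integer `≤ z` -/
def floorO (z : ℝ) : ℤ := 2 * ⌊(z + 1) / 2⌋ - 1
/-- indicator of `ℤ ⊆ ℝ` -/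
def chiZ (z : ℝ) : ℕ := if ∃ n : ℤ, z = n then 1 else 0
/-- indicator of the even integers -/
def chiE (z : ℝ) : ℕ := if ∃ n : ℤ, z = 2 * n then 1 else 0
/-- indicator of the odd integers -/
def chiO (z : ℝ) : ℕ := if ∃ n : ℤ, z = 2 * n + 1 then 1 else 0
/-- `η_e`: `1` on even integers `≥ 2`, `-1` on even integers `≤ 0`, `0` otherwise -/
def etaE (z : ℝ) : ℤ := if ∃ n : ℤ, z = 2 * n then (if 2 ≤ z then 1 else -1) else 0
/-- `η_o`: `1` on odd integers `≥ 1`, `-1` on odd integers `≤ -1`, `0` otherwise -/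
def etaO (z : ℝ) : ℤ := if ∃ n : ℤ, z = 2 * n + 1 then (if 1 ≤ z then 1 else -1) else 0
/-- `η = η_e + η_o` -/
def eta (z : ℝ) : ℤ := etaE z + etaO z

/-- `geomS c v m` is the truncated geometric series `(1 - (c·x^v)^m)/(1 - c·x^v)`,
a genuine element of `F[ℝ^r]`; it is the unique element with
`(1 - c·x^v) * geomS c v m = 1 - c^m·x^{m v}`. -/
def geomS (c : F) (v : E r) (m : ℤ) : QA F r :=
  if 0 ≤ m then ∑ t ∈ Finset.range m.toNat, c ^ (t : ℤ) • X F r ((t : ℝ) • v)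
  else -∑ t ∈ Finset.range (-m).toNat, c ^ (-(t : ℤ) - 1) • X F r ((-(t : ℝ) - 1) • v)

/-! ### Truncated divided difference operators and Demazure–Lusztig operators -/

/-- `∇_i(x^y) = ((1 - (x_{i+1}/x_i)^{⌊y_i - y_{i+1}⌋})/(1 - x_i/x_{i+1}))·x^y`. -/
def nablaIel (i : ℕ) (y : E r) : QA F r :=
  geomS F r 1 (epsV r i - epsV r (i + 1)) (-⌊cd r y i - cd r y (i + 1)⌋) * X F r y

/-- `∇_r^e(x^y) = ((1 - x_r^{-⌊2y_r⌋_e})/(1 - x_r^2))·x^y`. -/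
def nablaReEl (y : E r) : QA F r :=
  geomS F r 1 ((2 : ℝ) • epsV r r) (-floorE (2 * cd r y r) / 2) * X F r y

/-- `∇_r^o(x^y) = ((x_r - x_r^{-⌊2y_r⌋_o})/(1 - x_r^2))·x^y`. -/
def nablaRoEl (y : E r) : QA F r :=
  X F r (epsV r r) *
    geomS F r 1 ((2 : ℝ) • epsV r r) ((-floorO (2 * cd r y r) - 1) / 2) * X F r y

def nablaIop (i : ℕ) : Module.End F (QA F r) := mkOp F r (nablaIel F r i)
def nablaReOp : Module.End F (QA F r) := mkOp F r (nablaReEl F r)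
def nablaRoOp : Module.End F (QA F r) := mkOp F r (nablaRoEl F r)

/-- The value of the truncated Demazure–Lusztig operator `T_i` (`1 ≤ i ≤ r`) on `x^y`. -/
def Tel (k kr ur : F) (i : ℕ) (y : E r) : QA F r :=
  if i = r then
    (kr ^ chiE (2 * cd r y r) * ur ^ chiO (2 * cd r y r)) • X F r (sW r r y)
      + (kr - kr⁻¹) • nablaReEl F r y + (ur - ur⁻¹) • nablaRoEl F r y
  else
    k ^ chiZ (cd r y i - cd r y (i + 1)) • X F r (sW r i y)
      + (k - k⁻¹) • nablaIel F r i y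

/-- The truncated Demazure–Lusztig operators `T_1, …, T_r` on `F[ℝ^r]`. -/
def Top (k kr ur : F) (i : ℕ) : Module.End F (QA F r) := mkOp F r (Tel F r k kr ur i)

/-! ### The torus and the affine generator -/

/-- `t^{ε_i}`: the `i`-th coordinate (`1`-based) of an element of the torus `T = (Fˣ)^r`. -/
def tcU (t : Fin r → Fˣ) (i : ℕ) : Fˣ := ∏ m : Fin r, if (m : ℕ) + 1 = i then t m else 1

/-- `t^λ` for `λ ∈ ℤ^r`. -/
def upow (t : Fin r → Fˣ) (lam : Fin r → ℤ) : Fˣ := ∏ m : Fin r, t m ^ lam m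

/-- `t^v` for a vector `v` with integral entries (entries read off via the floor). -/
def upowR (t : Fin r → Fˣ) (v : E r) : Fˣ := ∏ m : Fin r, t m ^ ⌊v m⌋

/-- The `W`-action on the torus `T = (Fˣ)^r`: for `g = τ(λ)w₀ ∈ W` (so `g y = w₀ y + λ`),
`(g t)_m = q^{λ_m} · t^{w₀⁻¹ ε_m}`, where `W₀` permutes and inverts coordinates and
`τ(λ) t = q^λ t`, with `q = (q^{1/2})²`. -/
def torusAct (qh : Fˣ) (g : E r → E r) (t : Fin r → Fˣ) : Fin r → Fˣ := fun m =>
  (qh * qh) ^ ⌊g 0 m⌋ * ∏ j : Fin r, t j ^ ⌊(g (eV r j) - g 0) m⌋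

/-- The action on the torus of the linear part of `g` alone (the `W₀`-action). -/
def torusAct0 (g : E r → E r) (t : Fin r → Fˣ) : Fin r → Fˣ := fun m =>
  ∏ j : Fin r, t j ^ ⌊(g (eV r j) - g 0) m⌋

/-- The simple affine roots `α₀(y) = 1 - 2y₁`, `α_i(y) = y_i - y_{i+1}` (`1 ≤ i < r`),
`α_r(y) = 2 y_r` as affine-linear functionals. -/
def alphaF (j : ℕ) (y : E r) : ℝ :=
  if j = 0 then 1 - 2 * cd r y 1
  else if j = r then 2 * cd r y r
  else cd r y j - cd r y (j + 1)

/-- `t^{α_j^∨}` where `α₀^∨ = (-ε₁, 1/2)`, `α_i^∨ = (ε_i - ε_{i+1}, 0)`, `α_r^∨ = (ε_r, 0)`. -/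
def tpowCo (qh : Fˣ) (t : Fin r → Fˣ) (j : ℕ) : Fˣ :=
  if j = 0 then qh * (tcU F r t 1)⁻¹
  else if j = r then tcU F r t r
  else tcU F r t j * (tcU F r t (j + 1))⁻¹

/-- The affine subtorus `T_𝒪 = {t ∈ T : t^{α_j^∨} = 1 whenever α_j(c^𝒪) = 0}`. -/
def TOset (qh : Fˣ) (O : Set (E r)) : Set (Fin r → Fˣ) :=
  {t | ∀ j : ℕ, j ≤ r → alphaF r j (cpt r O) = 0 → tpowCo F r qh t j = 1}

/-- `∇₀^e(x^y) = ((1 - (q^{-1/2}x₁)^{⌊-2y₁⌋_e})/(1 - q x₁^{-2}))·x^y`. -/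
def nabla0eEl (qh : F) (y : E r) : QA F r :=
  geomS F r (qh * qh) ((-2 : ℝ) • epsV r 1) (-floorE (-2 * cd r y 1) / 2) * X F r y

/-- `∇₀^o(x^y) = ((q^{1/2}x₁^{-1} - (q^{-1/2}x₁)^{⌊-2y₁⌋_o})/(1 - q x₁^{-2}))·x^y`. -/
def nabla0oEl (qh : F) (y : E r) : QA F r :=
  (qh • X F r ((-1 : ℝ) • epsV r 1)) *
    geomS F r (qh * qh) ((-2 : ℝ) • epsV r 1) ((-floorO (-2 * cd r y 1) - 1) / 2) * X F r y

/-- The value of `T₀^𝒪` on `x^y`. -/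
def T0el (qh : Fˣ) (k0 u0 : F) (t : Fin r → Fˣ) (y : E r) : QA F r :=
  (k0 ^ chiE (2 * cd r y 1) * u0 ^ chiO (2 * cd r y 1) *
      ((tcU F r (torusAct F r qh (gfun r y) t) 1 : Fˣ) : F)) • X F r (sEps1 r y)
    + (k0 - k0⁻¹) • nabla0eEl F r qh y + (u0 - u0⁻¹) • nabla0oEl F r qh y

/-- The operator `T₀^𝒪` (as a globally defined operator; on `F[𝒪]` it is the operator of
the quasi-polynomial representation). -/
def T0op (qh : Fˣ) (k0 u0 : F) (t : Fin r → Fˣ) : Module.End F (QA F r) :=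
  mkOp F r (T0el F r qh k0 u0 t)

/-- The full family `T₀^𝒪, T₁, …, T_r`. -/
def Tfull (qh : Fˣ) (k0 u0 k kr ur : F) (t : Fin r → Fˣ) (j : ℕ) : Module.End F (QA F r) :=
  if j = 0 then T0op F r qh k0 u0 t else Top F r k kr ur j

/-- The Hecke parameter `k_j` (`k₀`, `k` or `k_r`). -/
def kpar (k0 k kr : F) (j : ℕ) : F := if j = 0 then k0 else if j = r then kr else k

/-- `(T_j^𝒪)⁻¹ = T_j^𝒪 - k_j + k_j⁻¹` (the inverse on `F[𝒪]`, by the Hecke relation). -/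
def TfullInv (qh : Fˣ) (k0 u0 k kr ur : F) (t : Fin r → Fˣ) (j : ℕ) : Module.End F (QA F r) :=
  Tfull F r qh k0 u0 k kr ur t j - (kpar F r k0 k kr j - (kpar F r k0 k kr j)⁻¹) • 1

/-- The word `0, 1, …, r-1, r, r-1, …, i` used in the definition of `Y_i^𝒪`. -/
def Ylist (i : ℕ) : List ℕ :=
  0 :: (((List.range (r - 1)).map (· + 1)) ++ [r] ++ ((List.range (r - i)).map fun m => r - 1 - m))

/-- The commuting operators
`Y_i^𝒪 = (T_{i-1}^𝒪)⁻¹⋯(T₁^𝒪)⁻¹ · T₀^𝒪 · T₁^𝒪⋯T_{r-1}^𝒪 · T_r^𝒪 · T_{r-1}^𝒪⋯T_i^𝒪`. -/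
def Yop (qh : Fˣ) (k0 u0 k kr ur : F) (t : Fin r → Fˣ) (i : ℕ) : Module.End F (QA F r) :=
  ((((List.range (i - 1)).map (· + 1)).reverse.map (TfullInv F r qh k0 u0 k kr ur t)).prod) *
    (((Ylist r i).map (Tfull F r qh k0 u0 k kr ur t)).prod)

/-! ### The base points `𝔰^𝒪`, `𝔰_y` and the spectrum -/

/-- `n_i^𝒪` (with `c = c^𝒪`), resp. `m_i(y)` (with `c = y`). -/
def nO (c : E r) (m : Fin r) : ℤ :=
  (∑ j : Fin r, if m < j then eta (c m - c j) + eta (c m + c j) else 0) +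
    ∑ j : Fin r, if j < m then eta (c j + c m) - eta (c j - c m) else 0

/-- The base point `𝔰^𝒪 ∈ T`. -/
def sOtor (k0 u0 k kr ur : Fˣ) (O : Set (E r)) : Fin r → Fˣ := fun m =>
  (k0 * kr) ^ (-(chiE (2 * cpt r O m) : ℤ)) * (u0 * ur) ^ (chiO (2 * cpt r O m) : ℤ) *
    k ^ nO r (cpt r O) m

/-- The eigenvalue `γ_i^𝒪(y) = ((g_y(𝔰^𝒪·t))_i)⁻¹`. -/
def gammaO (qh k0 u0 k kr ur : Fˣ) (O : Set (E r)) (t : Fin r → Fˣ) (i : ℕ) (y : E r) : Fˣ :=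
  (tcU F r (torusAct F r qh (gfun r y) fun m => sOtor F r k0 u0 k kr ur O m * t m) i)⁻¹

/-- `𝔰_y ∈ T`. -/
def sfrak (k0 u0 k kr ur : Fˣ) (y : E r) : Fin r → Fˣ := fun m =>
  (k0 * kr) ^ etaE (2 * y m) * (u0 * ur) ^ etaO (2 * y m) * k ^ nO r y m

/-! ### Finite Weyl group combinatorics, positive roots -/

/-- The set of positive roots of type `C_r`. -/
def PhiPlus : Set (E r) :=
  {v | (∃ a b : Fin r, a < b ∧ v = eV r a - eV r b) ∨
       (∃ a b : Fin r, a < b ∧ v = eV r a + eV r b) ∨ ∃ a : Fin r, v = (2 : ℝ) • eV r a}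

/-- The root system of type `C_r`. -/
def Phi0 : Set (E r) := PhiPlus r ∪ {v | -v ∈ PhiPlus r}

/-- The normalisation factor `κ_w^𝒪 = ∏_{α ∈ Π(w)} 𝐤_α^{χ_e(α(c))}·𝐤_{α/2}^{-χ_o(α(c))}`,
where `Π(w) = {α ∈ Φ₀⁺ : wα ∈ -Φ₀⁺}`, `𝐤_α = 𝐤_{α/2} = k` for short roots and
`𝐤_α = k_r`, `𝐤_{α/2} = u_r` for long roots. -/
def kappaW (k kr ur : Fˣ) (w : E r → E r) (c : E r) : Fˣ :=
  (∏ p : Fin r × Fin r,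
      if p.1 < p.2 ∧ -w (eV r p.1 - eV r p.2) ∈ PhiPlus r then
        k ^ ((chiE (ip r (eV r p.1 - eV r p.2) c) : ℤ) - (chiO (ip r (eV r p.1 - eV r p.2) c) : ℤ))
      else 1) *
  (∏ p : Fin r × Fin r,
      if p.1 < p.2 ∧ -w (eV r p.1 + eV r p.2) ∈ PhiPlus r then
        k ^ ((chiE (ip r (eV r p.1 + eV r p.2) c) : ℤ) - (chiO (ip r (eV r p.1 + eV r p.2) c) : ℤ))
      else 1) *
  ∏ a : Fin r,
      if -w ((2 : ℝ) • eV r a) ∈ PhiPlus r then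
        kr ^ (chiE (ip r ((2 : ℝ) • eV r a) c) : ℤ) * ur ^ (-(chiO (ip r ((2 : ℝ) • eV r a) c) : ℤ))
      else 1

/-- Iterated application `T_{i₁}(T_{i₂}(⋯(T_{i_ℓ}(f))⋯))`. -/
def applyT (k kr ur : F) (l : List ℕ) (f : QA F r) : QA F r :=
  l.foldr (fun i g => Top F r k kr ur i g) f

/-- The length function of the finite Weyl group `W₀`. -/
def w0len (g : E r → E r) : ℕ :=
  sInf {n | ∃ l : List ℕ, (∀ a ∈ l, 1 ≤ a ∧ a ≤ r) ∧ l.length = n ∧ (fun y => wordAct r l y) = g}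

/-- Membership in `W₀` (as maps on `ℝ^r`). -/
def IsW0fun (w : E r → E r) : Prop :=
  ∃ l : List ℕ, (∀ a ∈ l, 1 ≤ a ∧ a ≤ r) ∧ w = fun y => wordAct r l y

/-- Membership in the parabolic subgroup `W_{0,𝒪}` generated by the `s_i`, `1 ≤ i ≤ r`,
with `α_i(c^𝒪) = 0`. -/
def IsWOOfun (O : Set (E r)) (u : E r → E r) : Prop :=
  ∃ l : List ℕ, (∀ a ∈ l, 1 ≤ a ∧ a ≤ r ∧ alphaF r a (cpt r O) = 0) ∧
    u = fun y => wordAct r l y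

/-- `v ∈ W₀^𝒪`: `v ∈ W₀` of minimal length in its coset `v·W_{0,𝒪}`. -/
def MinRep (O : Set (E r)) (v : E r → E r) : Prop :=
  IsW0fun r v ∧ ∀ u, IsWOOfun r O u → w0len r v ≤ w0len r fun y => v (u y)

/-- Membership in the affine Weyl group `W` (as maps on `ℝ^r`). -/
def IsWfun (g : E r → E r) : Prop :=
  ∃ l : List ℕ, (∀ a ∈ l, a ≤ r) ∧ g = fun y => wordAct r l y

/-- Membership in the parabolic subgroup `W_{J(𝒪)}` generated by the `s_j`, `j ∈ J(𝒪)`. -/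
def IsWJfun (O : Set (E r)) (u : E r → E r) : Prop :=
  ∃ l : List ℕ, (∀ a ∈ l, a ≤ r ∧ alphaF r a (cpt r O) = 0) ∧ u = fun y => wordAct r l y

/-- The `W`-action on the Laurent polynomials `F[ℤ^r]` by `q`-dilations and reflections:
`w(x^μ) = x^{wμ}` for `w ∈ W₀`, `τ(λ)(x^μ) = q^{-⟨μ,λ⟩} x^μ` (globally defined via the
linear/translation parts of `g`). -/
def LWact (qh : Fˣ) (g : E r → E r) : Module.End F (QA F r) :=
  mkOp F r fun v => (((qh * qh) ^ (-⌊ip r (g v - g 0) (g 0)⌋) : Fˣ) : F) • X F r (g v - g 0)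

/-! ### roots `ᾱ_j`, torus reflections -/

/-- The finite simple roots `ᾱ₀ = -2ε₁`, `ᾱ_i = ε_i - ε_{i+1}`, `ᾱ_r = 2ε_r`
(as integral vectors). -/
def abarI (j : ℕ) : Fin r → ℤ := fun m =>
  if j = 0 then (if (m : ℕ) = 0 then -2 else 0)
  else if j = r then (if (m : ℕ) + 1 = r then 2 else 0)
  else if (m : ℕ) + 1 = j then 1
  else if (m : ℕ) = j then -1
  else 0

/-- The corresponding coroots `ᾱ₀^∨ = -ε₁`, `ᾱ_i^∨ = ε_i - ε_{i+1}`, `ᾱ_r^∨ = ε_r`. -/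
def abarV (j : ℕ) : Fin r → ℤ := fun m =>
  if j = 0 then (if (m : ℕ) = 0 then -1 else 0)
  else if j = r then (if (m : ℕ) + 1 = r then 1 else 0)
  else if (m : ℕ) + 1 = j then 1
  else if (m : ℕ) = j then -1
  else 0

/-- `ᾱ_j` as a real vector. -/
def abarR (j : ℕ) : E r := fun m => ((abarI r j m : ℤ) : ℝ)

/-- The constants `c₀ = u₀u_r`, `c_i = k²`, `c_r = k₀k_r`. -/
def cpar (k0 u0 k kr ur : Fˣ) (j : ℕ) : Fˣ :=
  if j = 0 then u0 * ur else if j = r then k0 * kr else k * k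

/-- The action of the reflection `s_{ᾱ_j} ∈ W₀` on the torus `T` (with `s_{ᾱ₀} = s_{ε₁}`). -/
def sTor (j : ℕ) (t : Fin r → Fˣ) : Fin r → Fˣ := fun m =>
  if j = 0 then (if (m : ℕ) = 0 then (t m)⁻¹ else t m)
  else if j = r then (if (m : ℕ) + 1 = r then (t m)⁻¹ else t m)
  else if (m : ℕ) + 1 = j then tcU F r t (j + 1)
  else if (m : ℕ) = j then tcU F r t j
  else t m

/-! ### The operators `G_t^𝒪(a)` for affine roots `a = (α, n)` -/

/-- The coroot `α^∨ = 2α/⟨α,α⟩`. -/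
def coroot (v : E r) : E r := ((2 : ℝ) / ip r v v) • v

/-- The scalar `q^{2n/⟨α,α⟩}` appearing in `x^{a^∨}` for `a = (α,n)`. -/
def qsc (qh : Fˣ) (v : E r) (n : ℤ) : Fˣ := if ip r v v = 4 then qh ^ n else (qh * qh) ^ n

/-- `𝐤_a`: `k` if `α` is short; `k_r` if `α` long, `n` even; `k₀` if `α` long, `n` odd. -/
def kaf (k0 k kr : Fˣ) (v : E r) (n : ℤ) : Fˣ :=
  if ip r v v = 4 then (if Even n then kr else k0) else k

/-- `𝐤_{a/2}`: `k` if `α` is short; `u_r` if `α` long, `n` even; `u₀` if `α` long, `n` odd. -/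
def khaf (u0 k ur : Fˣ) (v : E r) (n : ℤ) : Fˣ :=
  if ip r v v = 4 then (if Even n then ur else u0) else k

/-- The reflection `s_α(y) = y - α(y)·α^∨`. -/
def sRefl (v y : E r) : E r := y - ip r v y • coroot r v

/-- `s_{a,t}(x^y) = (g_y t)^{-n α^∨} · x^{s_α y}`. -/
def saTel (qh : Fˣ) (t : Fin r → Fˣ) (v : E r) (n : ℤ) (y : E r) : QA F r :=
  ((upowR F r (torusAct F r qh (gfun r y) t) (((-n : ℤ) : ℝ) • coroot r v) : Fˣ) : F) •
    X F r (sRefl r v y)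

/-- The twisted reflection operator `s_{a,t}`. -/
def SaOp (qh : Fˣ) (t : Fin r → Fˣ) (v : E r) (n : ℤ) : Module.End F (QA F r) :=
  mkOp F r (saTel F r qh t v n)

/-- The value `G_t^𝒪(a)(x^y)` for the affine root `a = (v, n)`. -/
def Gel (qh k0 u0 k kr ur : Fˣ) (t : Fin r → Fˣ) (v : E r) (n : ℤ) (y : E r) : QA F r :=
  (((kaf F r k0 k kr v n : Fˣ) : F) ^ chiE (ip r v y) *
      ((khaf F r u0 k ur v n : Fˣ) : F) ^ chiO (ip r v y)) • X F r y
    + ((((kaf F r k0 k kr v n : Fˣ) : F) - ((kaf F r k0 k kr v n : Fˣ) : F)⁻¹) •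
          geomS F r (((qsc F r qh v n)⁻¹ * (qsc F r qh v n)⁻¹ : Fˣ) : F)
            ((-2 : ℝ) • coroot r v) (-floorE (ip r v y) / 2)
        + (((khaf F r u0 k ur v n : Fˣ) : F) - ((khaf F r u0 k ur v n : Fˣ) : F)⁻¹) •
          ((((qsc F r qh v n)⁻¹ : Fˣ) : F) • X F r ((-1 : ℝ) • coroot r v) *
            geomS F r (((qsc F r qh v n)⁻¹ * (qsc F r qh v n)⁻¹ : Fˣ) : F)
              ((-2 : ℝ) • coroot r v) (-(floorO (ip r v y) + 1) / 2))) *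
      saTel F r qh t v n y

/-- The operator `G_t^𝒪(a)` for `a = (v, n)`. -/
def Gop (qh k0 u0 k kr ur : Fˣ) (t : Fin r → Fˣ) (v : E r) (n : ℤ) : Module.End F (QA F r) :=
  mkOp F r (Gel F r qh k0 u0 k kr ur t v n)

/-- The twisted action `g_t` of `g ∈ W` on `F[𝒪]`:
`g_t(x^y) = (g_{w₀ y} t)^{-λ} x^{w₀ y}` for `g = τ(λ) w₀`. -/
def Wtw (qh : Fˣ) (t : Fin r → Fˣ) (g : E r → E r) : Module.End F (QA F r) :=
  mkOp F r fun y =>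
    (((upowR F r (torusAct F r qh (gfun r (g y - g 0)) t) (g 0))⁻¹ : Fˣ) : F) •
      X F r (g y - g 0)

/-! ### The operators `D_j` -/

/-- The palindromic word `1, …, r-1, r, r-1, …, 1`. -/
def palin : List ℕ :=
  ((List.range (r - 1)).map (· + 1)) ++ [r] ++ ((List.range (r - 1)).map (· + 1)).reverse

/-- Multiplication by `x^{-ε₁}`. -/
def Mop : Module.End F (QA F r) := mkOp F r fun y => X F r ((-1 : ℝ) • epsV r 1) * X F r y

/-- `D₀ = (T₁^𝒪 ⋯ T_{r-1}^𝒪 T_r^𝒪 T_{r-1}^𝒪 ⋯ T₁^𝒪)⁻¹ ∘ M`. -/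
def D0op (qh : Fˣ) (k0 u0 k kr ur : F) (t : Fin r → Fˣ) : Module.End F (QA F r) :=
  ((palin r).map (TfullInv F r qh k0 u0 k kr ur t)).prod * Mop F r

/-- `D_j`: `D₀` for `j = 0` and `T_j^𝒪` for `1 ≤ j ≤ r`. -/
def Dop (qh : Fˣ) (k0 u0 k kr ur : F) (t : Fin r → Fˣ) (j : ℕ) : Module.End F (QA F r) :=
  if j = 0 then D0op F r qh k0 u0 k kr ur t else Tfull F r qh k0 u0 k kr ur t j

/-- Iterated application `D_{j₁}(D_{j₂}(⋯(D_{j_ℓ}(f))⋯))`. -/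
def applyD (qh : Fˣ) (k0 u0 k kr ur : F) (t : Fin r → Fˣ) (l : List ℕ) (f : QA F r) : QA F r :=
  l.foldr (fun j g => Dop F r qh k0 u0 k kr ur t j g) f

/-- The coefficients `k_{s_j}(y)`. -/
def ksj (k kr ur : Fˣ) (j : ℕ) (y : E r) : Fˣ :=
  if j = 0 then
    kr ^ (-etaE (2 * cd r y 1)) * ur ^ (-etaO (2 * cd r y 1)) *
      ∏ m : Fin r,
        (if 1 ≤ (m : ℕ) then k ^ (-eta (cd r y 1 - y m) - eta (cd r y 1 + y m)) else 1)
  else if j = r then kr ^ (-etaE (2 * cd r y r)) * ur ^ (-etaO (2 * cd r y r))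
  else k ^ (-eta (cd r y j - cd r y (j + 1)))

/-- `k_w(c) = ∏_m k_{s_{j_m}}(s_{j_{m+1}} ⋯ s_{j_ℓ} c)` for the word `w = s_{j₁} ⋯ s_{j_ℓ}`. -/
def kword (k kr ur : Fˣ) (l : List ℕ) (z : E r) : Fˣ :=
  (l.foldr (fun j p => (genF r j p.1, ksj F r k kr ur j p.1 * p.2)) (z, (1 : Fˣ))).2



/-! ### Auxiliary material: an explicit model of the affine Weyl group -/

section Aux

variable {F : Type*} [Field F] {r : ℕ}

/-- Signed permutations composed with integral translations. -/
structure AW (r : ℕ) where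
  p : Equiv.Perm (Fin r)
  s : Fin r → ℤˣ
  lam : Fin r → ℤ

namespace AW

def act (w : AW r) (y : E r) : E r := fun m => ((w.s m : ℤ) : ℝ) * y (w.p m) + (w.lam m : ℝ)

def tact (qh : Fˣ) (w : AW r) (t : Fin r → Fˣ) : Fin r → Fˣ := fun m =>
  (qh * qh) ^ (w.lam m) * t (w.p m) ^ ((w.s m : ℤˣ) : ℤ)

def comp (a b : AW r) : AW r :=
  ⟨a.p.trans b.p, fun m => a.s m * b.s (a.p m), fun m => a.s m * b.lam (a.p m) + a.lam m⟩

def inv (a : AW r) : AW r :=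
  ⟨a.p.symm, fun m => a.s (a.p.symm m), fun m => -(a.s (a.p.symm m) * a.lam (a.p.symm m))⟩

def lin (a : AW r) : AW r := ⟨a.p, a.s, 0⟩

def tr (mu : Fin r → ℤ) : AW r := ⟨Equiv.refl _, 1, mu⟩

def lz (w : AW r) (mu : Fin r → ℤ) : Fin r → ℤ := fun m => w.s m * mu (w.p m)

theorem act_comp (a b : AW r) (y : E r) : (a.comp b).act y = a.act (b.act y) := by
  funext m
  simp only [act, comp, Equiv.trans_apply]
  push_cast
  ring

theorem tact_comp (qh : Fˣ) (a b : AW r) (t : Fin r → Fˣ) :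
    (a.comp b).tact qh t = a.tact qh (b.tact qh t) := by
  funext m
  simp only [tact, comp, Equiv.trans_apply, Units.val_mul]
  generalize qh * qh = q
  rw [zpow_add, mul_zpow, ← zpow_mul, ← zpow_mul]
  rw [mul_comm ((a.s m : ℤˣ) : ℤ) (b.lam _), mul_comm ((a.s m : ℤˣ) : ℤ) ((b.s _ : ℤˣ) : ℤ)]
  rw [mul_comm (q ^ _) (q ^ (a.lam m)), mul_assoc]

theorem sq_s (e : ℤˣ) : (e : ℤ) * e = 1 := by
  rcases Int.units_eq_one_or e with h | h <;> simp [h]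

theorem sq_sR (e : ℤˣ) : ((e : ℤ) : ℝ) * ((e : ℤ) : ℝ) = 1 := by
  exact_mod_cast sq_s e

theorem inv_act (a : AW r) (y : E r) : a.inv.act (a.act y) = y := by
  funext m
  simp only [act, inv, Equiv.apply_symm_apply]
  push_cast
  linear_combination (y m) * sq_sR (a.s (a.p.symm m))

theorem act_inv (a : AW r) (y : E r) : a.act (a.inv.act y) = y := by
  funext m
  simp only [act, inv, Equiv.symm_apply_apply]
  push_cast
  linear_combination (y m - a.lam m) * sq_sR (a.s m)

theorem tact_inv (qh : Fˣ) (a : AW r) (t : Fin r → Fˣ) : a.tact qh (a.inv.tact qh t) = t := by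
  funext m
  simp only [tact, inv, Equiv.symm_apply_apply]
  generalize qh * qh = q
  rw [mul_zpow, ← zpow_mul, ← zpow_mul, sq_s, zpow_one, ← mul_assoc, ← zpow_add]
  have : a.lam m + -(((a.s m : ℤˣ) : ℤ) * a.lam m) * ((a.s m : ℤˣ) : ℤ) = 0 := by
    linear_combination (-a.lam m) * sq_s (a.s m)
  rw [this]; simp

theorem act_zero (a : AW r) : a.act 0 = zc r a.lam := by
  funext m; simp [act, zc]

theorem act_sub (a : AW r) (y : E r) : a.act y - a.act 0 = a.lin.act y := by
  funext m; simp [act, lin]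

theorem torusAct_act (qh : Fˣ) (a : AW r) (t : Fin r → Fˣ) :
    torusAct F r qh a.act t = a.tact qh t := by
  funext m
  simp only [torusAct, act_sub]
  simp only [act_zero, tact, zc, Int.floor_intCast]
  congr 1
  have : ∀ j, ⌊a.lin.act (eV r j) m⌋ = if j = a.p m then ((a.s m : ℤˣ) : ℤ) else 0 := by
    intro j
    simp only [act, lin, eV, Pi.zero_apply, Int.cast_zero, add_zero]
    by_cases h : j = a.p m
    · simp [h]
    · have h' : ¬ (a.p m = j) := fun h' => h h'.symm
      simp [h, h']
  simp only [this]
  rw [Finset.prod_eq_single (a.p m)]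
  · simp
  · intro b _ hb; simp [hb]
  · simp

end AW

theorem cd_succ (y : E r) (m : Fin r) : cd r y ((m : ℕ) + 1) = y m := by
  unfold cd
  rw [Finset.sum_eq_single m]
  · simp
  · intro b _ hb
    rw [if_neg]
    intro h; apply hb; apply Fin.ext; omega
  · simp

theorem tcU_succ (t : Fin r → Fˣ) (m : Fin r) : tcU F r t ((m : ℕ) + 1) = t m := by
  unfold tcU
  rw [Finset.prod_eq_single m]
  · simp
  · intro b _ hb
    rw [if_neg]
    intro h; apply hb; apply Fin.ext; omega
  · simp

theorem epsV_succ (m : Fin r) : epsV r ((m : ℕ) + 1) = eV r m := by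
  funext n
  simp [epsV, eV, Fin.ext_iff]

/-- Explicit form of the generators. -/
def swA (a b : Fin r) : AW r := ⟨Equiv.swap a b, 1, 0⟩
def ngA (a : Fin r) : AW r := ⟨Equiv.refl _, fun m => if m = a then -1 else 1, 0⟩
def nsA (a b : Fin r) : AW r :=
  ⟨Equiv.swap a b, fun m => if m = a ∨ m = b then -1 else 1, 0⟩
def g0A (a : Fin r) : AW r :=
  ⟨Equiv.refl _, fun m => if m = a then -1 else 1, fun m => if m = a then 1 else 0⟩

theorem swA_act (a b : Fin r) (y : E r) : (swA a b).act y = y ∘ Equiv.swap a b := by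
  funext m; simp [swA, AW.act]

theorem ngA_act (a : Fin r) (y : E r) : (ngA a).act y = Function.update y a (-y a) := by
  funext m
  by_cases h : m = a
  · subst h; simp [ngA, AW.act]
  · simp [ngA, AW.act, h]

theorem g0A_act (a : Fin r) (y : E r) : (g0A a).act y = Function.update y a (1 - y a) := by
  funext m
  by_cases h : m = a
  · subst h; simp [g0A, AW.act]; ring
  · simp [g0A, AW.act, h]

theorem sW_swap (y : E r) (a b : Fin r) (hab : (b : ℕ) = a + 1) :
    sW r ((a : ℕ) + 1) y = y ∘ Equiv.swap a b := by
  have hb := b.2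
  funext m
  have e : (a : ℕ) + 1 + 1 = (b : ℕ) + 1 := by omega
  simp only [sW, Function.comp]
  rw [if_neg (by omega)]
  rw [e, cd_succ, cd_succ]
  by_cases h1 : m = a
  · subst h1; simp
  · rw [if_neg (by intro h; apply h1; apply Fin.ext; omega)]
    by_cases h2 : m = b
    · subst h2; simp [hab]
    · rw [if_neg (by intro h; apply h2; apply Fin.ext; omega), Equiv.swap_apply_of_ne_of_ne h1 h2]

theorem sW_neg (y : E r) (a : Fin r) (ha : (a : ℕ) + 1 = r) :
    sW r r y = Function.update y a (-y a) := by
  funext m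
  simp only [sW, if_true]
  by_cases h : m = a
  · subst h; simp [ha]
  · rw [if_neg (by intro h'; apply h; apply Fin.ext; omega)]; simp [h]

theorem genF_zero (y : E r) (a : Fin r) (ha : (a : ℕ) = 0) :
    genF r 0 y = Function.update y a (1 - y a) := by
  funext m
  simp only [genF, if_true]
  by_cases h : m = a
  · subst h; simp [ha]
  · rw [if_neg (by intro h'; apply h; apply Fin.ext; omega)]; simp [h]

theorem gen_cases (hr : 2 ≤ r) (j : ℕ) (hj : j ≤ r) :
    (∃ a : Fin r, (a : ℕ) = 0 ∧ j = 0 ∧ ∀ y, genF r j y = (g0A a).act y) ∨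
    (∃ a : Fin r, (a : ℕ) + 1 = r ∧ j = r ∧ ∀ y, genF r j y = (ngA a).act y) ∨
    (∃ a b : Fin r, (b : ℕ) = a + 1 ∧ j = a + 1 ∧ ∀ y, genF r j y = (swA a b).act y) := by
  rcases Nat.eq_zero_or_pos j with h0 | h0
  · left
    subst h0
    exact ⟨⟨0, by omega⟩, rfl, rfl, fun y => by rw [g0A_act]; exact genF_zero y _ rfl⟩
  rcases Nat.lt_or_ge j r with h1 | h1
  · right; right
    refine ⟨⟨j - 1, by omega⟩, ⟨j, h1⟩, ?_, ?_, fun y => ?_⟩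
    · simp; omega
    · simp; omega
    · rw [swA_act, genF, if_neg (by omega)]
      rw [← sW_swap y ⟨j - 1, by omega⟩ ⟨j, h1⟩ (by simp; omega)]
      congr 1; simp; omega
  · right; left
    have : j = r := by omega
    subst this
    refine ⟨⟨j - 1, by omega⟩, by simp; omega, rfl, fun y => ?_⟩
    rw [ngA_act, genF, if_neg (by omega)]
    exact sW_neg y _ (by simp; omega)

theorem genF_inv (hr : 2 ≤ r) (j : ℕ) (hj : j ≤ r) (y : E r) : genF r j (genF r j y) = y := by
  rcases gen_cases hr j hj with ⟨a, -, -, h⟩ | ⟨a, -, -, h⟩ | ⟨a, b, -, -, h⟩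
  · simp only [h, g0A_act]; simp
  · simp only [h, ngA_act]; simp
  · simp only [h, swA_act]; funext m; simp

theorem word_append (l l' : List ℕ) (y : E r) :
    wordAct r (l ++ l') y = wordAct r l (wordAct r l' y) := by
  simp [wordAct]

theorem word_rev (hr : 2 ≤ r) (l : List ℕ) (hl : ∀ a ∈ l, a ≤ r) (y : E r) :
    wordAct r l (wordAct r l.reverse y) = y := by
  induction l generalizing y with
  | nil => rfl
  | cons a l ih =>
    rw [List.reverse_cons, word_append]
    have := ih (fun b hb => hl b (List.mem_cons_of_mem _ hb)) (wordAct r [a] y)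
    change genF r a (wordAct r l _) = y
    rw [this]
    exact genF_inv hr a (hl a List.mem_cons_self) y

theorem word_AW (hr : 2 ≤ r) (l : List ℕ) (hl : ∀ a ∈ l, a ≤ r) :
    ∃ w : AW r, ∀ y, wordAct r l y = w.act y := by
  induction l with
  | nil => exact ⟨AW.tr 0, fun y => by funext m; simp [wordAct, AW.act, AW.tr]⟩
  | cons a l ih =>
    obtain ⟨w, hw⟩ := ih (fun b hb => hl b (List.mem_cons_of_mem _ hb))
    have : ∃ v : AW r, ∀ y, genF r a y = v.act y := by
      rcases gen_cases hr a (hl a List.mem_cons_self) with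
        ⟨a, -, -, h⟩ | ⟨a, -, -, h⟩ | ⟨a, b, -, -, h⟩
      exacts [⟨_, h⟩, ⟨_, h⟩, ⟨_, h⟩]
    obtain ⟨v, hv⟩ := this
    refine ⟨v.comp w, fun y => ?_⟩
    rw [AW.act_comp, ← hw, ← hv]; rfl

/-- Reachability by words. -/
def Rch (y z : E r) : Prop := ∃ l : List ℕ, (∀ a ∈ l, a ≤ r) ∧ wordAct r l y = z

theorem Rch.refl (y : E r) : Rch y y := ⟨[], by simp, rfl⟩

theorem Rch.trans {y z u : E r} (h : Rch y z) (h' : Rch z u) : Rch y u := by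
  obtain ⟨l, hl, rfl⟩ := h
  obtain ⟨l', hl', rfl⟩ := h'
  refine ⟨l' ++ l, ?_, word_append _ _ _⟩
  intro a ha
  rcases List.mem_append.1 ha with h | h
  exacts [hl' a h, hl a h]

theorem Rch.gen (j : ℕ) (hj : j ≤ r) (y : E r) : Rch y (genF r j y) :=
  ⟨[j], by simpa using hj, rfl⟩

theorem Rch.perm (hr : 2 ≤ r) (p : Equiv.Perm (Fin r)) (y : E r) : Rch y (y ∘ p) := by
  obtain ⟨n, rfl⟩ : ∃ n, r = n + 1 := ⟨r - 1, by omega⟩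
  have hp : p ∈ Submonoid.closure (Set.range fun i : Fin n ↦ Equiv.swap i.castSucc i.succ) := by
    rw [Equiv.Perm.mclosure_swap_castSucc_succ]; trivial
  induction hp using Submonoid.closure_induction generalizing y with
  | mem x hx =>
    obtain ⟨i, rfl⟩ := hx
    have := Rch.gen (r := n + 1) ((i : ℕ) + 1) (by omega) y
    rw [genF, if_neg (by omega)] at this
    have h2 := sW_swap y i.castSucc i.succ (by simp)
    simp only [Fin.val_castSucc] at h2
    rwa [h2] at this
  | one => exact Rch.refl _
  | mul a b _ _ ha hb => exact (ha y).trans (hb (y ∘ a))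

theorem update_swap (y : E r) (a b : Fin r) (x : ℝ) :
    (Function.update (y ∘ Equiv.swap a b) b x) ∘ Equiv.swap a b = Function.update y a x := by
  funext m
  by_cases h : m = a
  · subst h; simp
  · have : Equiv.swap a b m ≠ b := by
      intro h'; apply h
      have := congrArg (Equiv.swap a b) h'
      simpa using this
    simp [h, this]

theorem Rch.neg (hr : 2 ≤ r) (a : Fin r) (y : E r) : Rch y (Function.update y a (-y a)) := by
  have hb : ((⟨r - 1, by omega⟩ : Fin r) : ℕ) + 1 = r := by simp; omega
  generalize (⟨r - 1, by omega⟩ : Fin r) = b at hb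
  have h1 := Rch.perm hr (Equiv.swap a b) y
  have h2 := Rch.gen (r := r) r le_rfl (y ∘ Equiv.swap a b)
  rw [genF, if_neg (by omega), sW_neg _ b hb] at h2
  have h3 := (h1.trans h2).trans (Rch.perm hr (Equiv.swap a b) _)
  rw [update_swap] at h3
  simpa using h3

theorem Rch.one_sub (hr : 2 ≤ r) (a : Fin r) (y : E r) :
    Rch y (Function.update y a (1 - y a)) := by
  have hb : ((⟨0, by omega⟩ : Fin r) : ℕ) = 0 := rfl
  generalize (⟨0, by omega⟩ : Fin r) = b at hb
  have h1 := Rch.perm hr (Equiv.swap a b) y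
  have h2 := Rch.gen (r := r) 0 (by omega) (y ∘ Equiv.swap a b)
  rw [genF_zero _ b hb] at h2
  have h3 := (h1.trans h2).trans (Rch.perm hr (Equiv.swap a b) _)
  rw [update_swap] at h3
  simpa using h3

theorem Rch.addNat (hr : 2 ≤ r) (a : Fin r) (n : ℕ) (y : E r) :
    Rch y (Function.update y a (y a + n)) ∧ Rch y (Function.update y a (y a - n)) := by
  induction n with
  | zero => simp [Rch.refl]
  | succ n ih =>
    constructor
    · have h1 := (ih.1.trans (Rch.neg hr a _)).trans (Rch.one_sub hr a _)
      simp only [Function.update_self, Function.update_idem] at h1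
      convert h1 using 2; push_cast; ring
    · have h1 := (ih.2.trans (Rch.one_sub hr a _)).trans (Rch.neg hr a _)
      simp only [Function.update_self, Function.update_idem] at h1
      convert h1 using 2; push_cast; ring

theorem Rch.coord (hr : 2 ≤ r) (a : Fin r) (y : E r) :
    ∃ x : ℝ, 0 ≤ x ∧ x ≤ 1 / 2 ∧ Rch y (Function.update y a x) := by
  have h1 : Rch y (Function.update y a (Int.fract (y a))) := by
    rcases Int.eq_nat_or_neg ⌊y a⌋ with ⟨n, hn | hn⟩
    · have := (Rch.addNat hr a n y).2
      convert this using 2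
      rw [Int.fract, hn]; simp
    · have := (Rch.addNat hr a n y).1
      convert this using 2
      rw [Int.fract, hn]; simp
  by_cases h : Int.fract (y a) ≤ 1 / 2
  · exact ⟨_, Int.fract_nonneg _, h, h1⟩
  · have h2 := h1.trans (Rch.one_sub hr a _)
    simp only [Function.update_self, Function.update_idem] at h2
    have := Int.fract_lt_one (y a)
    exact ⟨_, by linarith, by linarith, h2⟩

theorem Rch.box (hr : 2 ≤ r) (s : Finset (Fin r)) (y : E r) :
    ∃ z : E r, Rch y z ∧ ∀ m ∈ s, 0 ≤ z m ∧ z m ≤ 1 / 2 := by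
  induction s using Finset.induction_on with
  | empty => exact ⟨y, Rch.refl y, by simp⟩
  | insert a s ha ih =>
    obtain ⟨z, hz, hs⟩ := ih
    obtain ⟨x, hx0, hx1, hx⟩ := Rch.coord hr a z
    refine ⟨_, hz.trans hx, fun m hm => ?_⟩
    by_cases h : m = a
    · subst h; simpa using ⟨hx0, by simpa using hx1⟩
    · rw [Function.update_of_ne h]
      exact hs m ((Finset.mem_insert.1 hm).resolve_left h)

theorem Rch.alcove (hr : 2 ≤ r) (y : E r) : ∃ z ∈ CplusCl r, Rch y z := by
  obtain ⟨z, hz, hb⟩ := Rch.box hr Finset.univ y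
  have hs := Tuple.monotone_sort (fun m => -z m)
  refine ⟨z ∘ Tuple.sort (fun m => -z m), ⟨?_, fun m => hb _ (Finset.mem_univ _)⟩,
    hz.trans (Rch.perm hr _ z)⟩
  intro i j hij
  have := hs hij
  simpa using this

theorem gfun_spec (hr : 2 ≤ r) (y : E r) :
    ∃ A : AW r, gfun r y = A.act ∧ ∃ z ∈ CplusCl r, A.act z = y := by
  have hex : ∃ l : List ℕ, (∀ a ∈ l, a ≤ r) ∧ wordAct r l.reverse y ∈ CplusCl r ∧
      ∀ l' : List ℕ, (∀ a ∈ l', a ≤ r) → wordAct r l'.reverse y ∈ CplusCl r →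
        l.length ≤ l'.length := by
    obtain ⟨z, hz, l, hl, rfl⟩ := Rch.alcove hr y
    have hne : ∃ n, ∃ l : List ℕ, l.length = n ∧ (∀ a ∈ l, a ≤ r) ∧
        wordAct r l.reverse y ∈ CplusCl r :=
      ⟨_, l.reverse, rfl, by simpa using hl, by simpa using hz⟩
    obtain ⟨l0, h0, h1, h2⟩ := Nat.find_spec hne
    refine ⟨l0, h1, h2, fun l' h3 h4 => ?_⟩
    rw [h0]
    exact Nat.find_min' hne ⟨l', rfl, h3, h4⟩
  have hg : gW r y = hex.choose := by rw [gW, dif_pos hex]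
  obtain ⟨h1, h2, -⟩ := hex.choose_spec
  rw [← hg] at h1 h2
  obtain ⟨A, hA⟩ := word_AW hr _ h1
  refine ⟨A, ?_, _, h2, ?_⟩
  · funext z; exact hA z
  · rw [← hA]; exact word_rev hr _ h1 y

/-- The torus condition. -/
def TC (qh : Fˣ) (c : E r) (t : Fin r → Fˣ) : Prop :=
  (∀ i j, c i = c j → t i = t j) ∧ (∀ i, c i = 0 → t i = 1) ∧ (∀ i, c i = 1 / 2 → t i = qh)

theorem TC_of (hr : 2 ≤ r) (qh : Fˣ) (c : E r) (hc : c ∈ CplusCl r) (t : Fin r → Fˣ)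
    (ht : ∀ j : ℕ, j ≤ r → alphaF r j c = 0 → tpowCo F r qh t j = 1) : TC qh c t := by
  have hadj : ∀ n : ℕ, ∀ i j : Fin r, (j : ℕ) = i + n → c i = c j → t i = t j := by
    intro n
    induction n with
    | zero => intro i j h _; rw [show i = j from Fin.ext (by omega)]
    | succ n ih =>
      intro i j h hij
      have hj := j.2
      let k : Fin r := ⟨i + n, by omega⟩
      have hk : (k : ℕ) = i + n := rfl
      have h1 : c k ≤ c i := hc.1 i k (by rw [Fin.le_def]; omega)
      have h2 : c j ≤ c k := hc.1 k j (by rw [Fin.le_def]; omega)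
      rw [ih i k hk (by linarith)]
      have := ht ((k : ℕ) + 1) (by omega)
      have e : (k : ℕ) + 1 + 1 = (j : ℕ) + 1 := by omega
      rw [alphaF, tpowCo, if_neg (by omega), if_neg (by omega), if_neg (by omega),
        if_neg (by omega), e, cd_succ, cd_succ, tcU_succ, tcU_succ] at this
      exact mul_inv_eq_one.1 (this (by linarith))
  have hA : ∀ i j, c i = c j → t i = t j := by
    intro i j h
    rcases le_total (i : ℕ) j with h1 | h1
    · exact hadj (j - i) i j (by omega) h
    · exact (hadj (i - j) j i (by omega) h.symm).symm
  refine ⟨hA, fun i hi => ?_, fun i hi => ?_⟩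
  · let k : Fin r := ⟨r - 1, by omega⟩
    have hk : (k : ℕ) + 1 = r := by simp only [k]; omega
    have h2 : c k ≤ c i := hc.1 i k (by rw [Fin.le_def]; omega)
    have h3 := (hc.2 k).1
    have h4 : c k = 0 := by linarith
    have := ht r le_rfl
    rw [alphaF, tpowCo, if_neg (by omega), if_pos rfl, if_neg (by omega), if_pos rfl] at this
    have e1 : cd r c r = c k := by
      have := cd_succ c k
      rwa [hk] at this
    have e2 : tcU F r t r = t k := by
      have := tcU_succ t k
      rwa [hk] at this
    rw [e1, e2] at this
    rw [hA i k (by linarith)]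
    exact this (by rw [h4]; simp)
  · let k : Fin r := ⟨0, by omega⟩
    have hk : (k : ℕ) + 1 = 1 := rfl
    have h2 : c i ≤ c k := hc.1 k i (by rw [Fin.le_def]; exact Nat.zero_le _)
    have h3 := (hc.2 k).2
    have := ht 0 (by omega)
    rw [alphaF, tpowCo, if_pos rfl, if_pos rfl, ← hk, cd_succ, tcU_succ] at this
    rw [hA i k (by linarith)]
    exact (mul_inv_eq_one.1 (this (by linarith))).symm

theorem fix_pt (w : AW r) (c c' : E r) (hc : c ∈ CplusCl r) (hc' : c' ∈ CplusCl r)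
    (h : w.act c = c') : c' = c ∧ ∀ (qh : Fˣ) (t : Fin r → Fˣ), TC qh c t → w.tact qh t = t := by
  have key : ∀ m, c' m = c (w.p m) ∧ ((w.s m = 1 ∧ w.lam m = 0) ∨
      (w.s m = -1 ∧ w.lam m = 0 ∧ c' m = 0) ∨ (w.s m = -1 ∧ w.lam m = 1 ∧ c' m = 1 / 2)) := by
    intro m
    have h1 : w.act c m = c' m := congrFun h m
    obtain ⟨ha, hb⟩ := hc'.2 m
    obtain ⟨ha', hb'⟩ := hc.2 (w.p m)
    rcases Int.units_eq_one_or (w.s m) with hs | hs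
    · simp only [AW.act, hs, Units.val_one, Int.cast_one, one_mul] at h1
      have l1 : (w.lam m : ℝ) < 1 := by linarith
      have l2 : (-1 : ℝ) < (w.lam m : ℝ) := by linarith
      have l3 : w.lam m = 0 := by
        have : w.lam m < 1 := by exact_mod_cast l1
        have : -1 < w.lam m := by exact_mod_cast l2
        omega
      rw [l3] at h1
      refine ⟨by simpa using h1.symm, Or.inl ⟨hs, l3⟩⟩
    · simp only [AW.act, hs, Units.val_neg, Units.val_one, Int.cast_neg, Int.cast_one] at h1
      have l1 : (w.lam m : ℝ) < 2 := by linarith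
      have l2 : (-1 : ℝ) < (w.lam m : ℝ) := by linarith
      have l3 : w.lam m = 0 ∨ w.lam m = 1 := by
        have : w.lam m < 2 := by exact_mod_cast l1
        have : -1 < w.lam m := by exact_mod_cast l2
        omega
      rcases l3 with l3 | l3
      · rw [l3] at h1
        push_cast at h1
        exact ⟨by linarith, Or.inr (Or.inl ⟨hs, l3, by linarith⟩)⟩
      · rw [l3] at h1
        push_cast at h1
        exact ⟨by linarith, Or.inr (Or.inr ⟨hs, l3, by linarith⟩)⟩
  have hcc : c' = c ∘ w.p := by funext m; exact (key m).1
  have e : c' = c := by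
    have h1 : Antitone (c ∘ w.p) := by rw [← hcc]; exact fun i j hij => hc'.1 i j hij
    have h2 : Antitone (c ∘ (Equiv.refl (Fin r))) := fun i j hij => hc.1 i j hij
    have := Tuple.unique_antitone h1 h2
    rw [hcc, this]; rfl
  refine ⟨e, fun qh t ⟨t1, t2, t3⟩ => ?_⟩
  funext m
  obtain ⟨k1, k2⟩ := key m
  rw [e] at k1 k2
  rw [AW.tact, ← t1 _ _ k1]
  rcases k2 with ⟨a, b⟩ | ⟨a, b, d⟩ | ⟨a, b, d⟩
  · simp [a, b]
  · simp [a, b, t2 m d]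
  · simp [a, b, t3 m d]

/-- The properties of the family `τ_y = g_y t` used below. -/
structure Equiv' (qh : Fˣ) (O : Set (E r)) (τ : E r → Fin r → Fˣ) : Prop where
  mem : ∀ y ∈ O, ∀ w : AW r, w.act y ∈ O
  eqv : ∀ y ∈ O, ∀ w : AW r, τ (w.act y) = w.tact qh (τ y)

theorem exists_equiv (hr : 2 ≤ r) (qh : Fˣ) (O : Set (E r)) (hO : IsOrbit r O)
    (t : Fin r → Fˣ) (ht : t ∈ TOset F r qh O) :
    ∃ O' : Set (E r), O ⊆ O' ∧ Equiv' qh O' (fun y => torusAct F r qh (gfun r y) t) := by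
  obtain ⟨y0, rfl⟩ := hO
  have hex : ∃ c, c ∈ orbit r y0 ∧ c ∈ CplusCl r := by
    obtain ⟨z, hz, h⟩ := Rch.alcove hr y0
    exact ⟨z, h, hz⟩
  have hcp : cpt r (orbit r y0) = hex.choose := by rw [cpt, dif_pos hex]
  obtain ⟨hc1, hc2⟩ := hex.choose_spec
  rw [← hcp] at hc1 hc2
  set c := cpt r (orbit r y0) with hcdef
  have hTC : TC qh c t := TC_of hr qh c hc2 t ht
  refine ⟨{y | ∃ w : AW r, y = w.act c}, ?_, ?_, ?_⟩
  · rintro y ⟨l, hl, rfl⟩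
    obtain ⟨l', hl', h'⟩ := hc1
    obtain ⟨a, ha⟩ := word_AW hr l hl
    obtain ⟨b, hb⟩ := word_AW hr l' hl'
    refine ⟨a.comp b.inv, ?_⟩
    rw [AW.act_comp, ← h', hb, AW.inv_act, ha]
  · rintro y ⟨v, rfl⟩ w
    exact ⟨w.comp v, (AW.act_comp _ _ _).symm⟩
  · rintro y ⟨v, rfl⟩ h
    obtain ⟨A, hA, z, hz, hAz⟩ := gfun_spec hr (v.act c)
    obtain ⟨B, hB, z', hz', hBz⟩ := gfun_spec hr (h.act (v.act c))
    have e1 : z = c := by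
      refine (fix_pt (F := F) (A.inv.comp v) c z hc2 hz ?_).1
      rw [AW.act_comp, ← hAz, AW.inv_act]
    rw [e1] at hAz
    have e2 := (fix_pt (F := F) (B.inv.comp (h.comp A)) c z' hc2 hz' (by
      rw [AW.act_comp, AW.act_comp, hAz, ← hBz, AW.inv_act])).2 qh t hTC
    simp only [hA, hB, AW.torusAct_act]
    rw [AW.tact_comp, AW.tact_comp] at e2
    rw [← AW.tact_inv qh B (h.tact qh (A.tact qh t)), e2]



/-! ### Auxiliary material: algebra -/

/-- integral inner product -/
def iz (a b : Fin r → ℤ) : ℤ := ∑ m, a m * b m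

theorem zc_add (a b : Fin r → ℤ) : zc r (a + b) = zc r a + zc r b := by
  funext m; simp [zc]

theorem zc_smul (n : ℤ) (a : Fin r → ℤ) : zc r (n • a) = (n : ℝ) • zc r a := by
  funext m; simp [zc]

theorem zc_inj {a b : Fin r → ℤ} (h : zc r a = zc r b) : a = b := by
  funext m
  have := congrFun h m
  simpa [zc] using this

theorem ip_zc (a b : Fin r → ℤ) : ip r (zc r a) (zc r b) = (iz a b : ℝ) := by
  simp [ip, zc, iz]

theorem iz_comm (a b : Fin r → ℤ) : iz a b = iz b a := by
  simp only [iz, mul_comm]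

theorem iz_smul_left (n : ℤ) (a b : Fin r → ℤ) : iz (n • a) b = n * iz a b := by
  simp [iz, Finset.mul_sum, mul_assoc]

theorem iz_smul_right (n : ℤ) (a b : Fin r → ℤ) : iz a (n • b) = n * iz a b := by
  rw [iz_comm, iz_smul_left, iz_comm]

theorem ip_smul_left (c : ℝ) (v y : E r) : ip r (c • v) y = c * ip r v y := by
  simp [ip, Finset.mul_sum, mul_assoc]

theorem ip_lin (w : AW r) (v y : E r) : ip r (w.lin.act v) (w.lin.act y) = ip r v y := by
  unfold ip
  rw [← Equiv.sum_comp w.p (fun m => v m * y m)]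
  refine Finset.sum_congr rfl fun m _ => ?_
  simp only [AW.act, AW.lin, Pi.zero_apply, Int.cast_zero, add_zero]
  linear_combination (v (w.p m) * y (w.p m)) * AW.sq_sR (w.s m)

theorem lin_add (w : AW r) (y z : E r) : w.lin.act (y + z) = w.lin.act y + w.lin.act z := by
  funext m; simp [AW.act, AW.lin]; ring

theorem lin_sub (w : AW r) (y z : E r) : w.lin.act (y - z) = w.lin.act y - w.lin.act z := by
  funext m; simp [AW.act, AW.lin]; ring

theorem lin_smul (w : AW r) (c : ℝ) (y : E r) : w.lin.act (c • y) = c • w.lin.act y := by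
  funext m; simp [AW.act, AW.lin]; ring

theorem lin_zc (w : AW r) (a : Fin r → ℤ) : w.lin.act (zc r a) = zc r (w.lz a) := by
  funext m; simp [AW.act, AW.lin, AW.lz, zc]

theorem lz_smul (w : AW r) (n : ℤ) (a : Fin r → ℤ) : w.lz (n • a) = n • w.lz a := by
  funext m; simp [AW.lz]; ring

theorem iz_lz (w : AW r) (a b : Fin r → ℤ) : iz (w.lz a) (w.lz b) = iz a b := by
  have := ip_lin w (zc r a) (zc r b)
  rw [lin_zc, lin_zc, ip_zc, ip_zc] at this
  exact_mod_cast this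

theorem tr_act (a : Fin r → ℤ) (y : E r) : (AW.tr a).act y = y + zc r a := by
  funext m; simp [AW.tr, AW.act, zc]

theorem upowR_zc (t : Fin r → Fˣ) (a : Fin r → ℤ) : upowR F r t (zc r a) = upow F r t a := by
  simp [upowR, upow, zc]

theorem upow_add (t : Fin r → Fˣ) (a b : Fin r → ℤ) :
    upow F r t (a + b) = upow F r t a * upow F r t b := by
  simp [upow, zpow_add, Finset.prod_mul_distrib]

theorem upow_smul (t : Fin r → Fˣ) (n : ℤ) (a : Fin r → ℤ) :
    upow F r t (n • a) = upow F r t a ^ n := by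
  simp only [upow, Pi.smul_apply, smul_eq_mul]
  rw [← Finset.prod_zpow]
  refine Finset.prod_congr rfl fun m _ => ?_
  rw [mul_comm, zpow_mul]

theorem upow_tr (qh : Fˣ) (t : Fin r → Fˣ) (a b : Fin r → ℤ) :
    upow F r ((AW.tr a).tact qh t) b = (qh * qh) ^ iz a b * upow F r t b := by
  have hs : ∀ (s : Finset (Fin r)) (q : Fˣ), q ^ (∑ m ∈ s, a m * b m)
      = ∏ m ∈ s, q ^ (a m * b m) := by
    intro s q
    induction s using Finset.induction_on with
    | empty => simp
    | insert x s hx ih => rw [Finset.sum_insert hx, Finset.prod_insert hx, zpow_add, ih]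
  rw [iz, hs, upow, upow, ← Finset.prod_mul_distrib]
  refine Finset.prod_congr rfl fun m _ => ?_
  simp only [AW.tact]
  generalize qh * qh = q
  simp [AW.tr, mul_zpow, zpow_mul]

theorem upow_lin (qh : Fˣ) (w : AW r) (t : Fin r → Fˣ) (a : Fin r → ℤ) :
    upow F r (w.lin.tact qh t) (w.lz a) = upow F r t a := by
  unfold upow
  rw [← Equiv.prod_comp w.p (fun m => t m ^ a m)]
  refine Finset.prod_congr rfl fun m _ => ?_
  simp only [AW.tact, AW.lin, AW.lz, Pi.zero_apply, zpow_zero, one_mul]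
  rw [← zpow_mul, ← mul_assoc, AW.sq_s, one_mul]

theorem mkOp_X (Ψ : E r → QA F r) (y : E r) : mkOp F r Ψ (X F r y) = Ψ y := by
  simp [mkOp, X]

theorem X_mul (y z : E r) : X F r y * X F r z = X F r (y + z) := by
  simp [X, AddMonoidAlgebra.single_mul_single]

theorem op_geom (A : Module.End F (QA F r)) (f : QA F r) (d : F) (v v' : E r)
    (h : ∀ n : ℤ, A (X F r ((n : ℝ) • v) * f) = d ^ n • (X F r ((n : ℝ) • v') * A f))
    (c : F) (m : ℤ) : A (geomS F r c v m * f) = geomS F r (c * d) v' m * A f := by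
  unfold geomS
  split_ifs with hm
  · rw [Finset.sum_mul, Finset.sum_mul, map_sum]
    refine Finset.sum_congr rfl fun i _ => ?_
    have := h i
    push_cast at this
    rw [smul_mul_assoc, smul_mul_assoc, map_smul, this, smul_smul, mul_zpow]
  · rw [neg_mul, neg_mul, map_neg, Finset.sum_mul, Finset.sum_mul, map_sum]
    congr 1
    refine Finset.sum_congr rfl fun i _ => ?_
    have := h (-i - 1)
    push_cast at this
    rw [smul_mul_assoc, smul_mul_assoc, map_smul, this, smul_smul, mul_zpow]

theorem geomS_zero (c : F) (v : E r) : geomS F r c v 0 = 0 := by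
  simp [geomS]

theorem geomS_succ (v : E r) (m : ℤ) :
    geomS F r 1 v (m + 1) = geomS F r 1 v m + X F r ((m : ℝ) • v) := by
  unfold geomS
  simp only [one_zpow, one_smul]
  rcases lt_trichotomy m (-1) with h | h | h
  · rw [if_neg (by omega), if_neg (by omega)]
    have : (-m).toNat = (-(m + 1)).toNat + 1 := by omega
    rw [this, Finset.sum_range_succ]
    have e : ((-(m + 1)).toNat : ℝ) = -(m + 1) := by
      have : (((-(m + 1)).toNat : ℤ) : ℝ) = ((-(m + 1) : ℤ) : ℝ) := by
        rw [Int.toNat_of_nonneg (by omega)]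
      push_cast at this
      simpa using this
    rw [e]
    have : (- -((m : ℝ) + 1) - 1) = m := by ring
    rw [this]
    abel
  · subst h; simp
  · rw [if_pos (by omega), if_pos (by omega)]
    have : (m + 1).toNat = m.toNat + 1 := by omega
    rw [this, Finset.sum_range_succ]
    have e : (m.toNat : ℝ) = m := by
      have : ((m.toNat : ℤ) : ℝ) = (m : ℝ) := by
        rw [Int.toNat_of_nonneg (by omega)]
      rw [Int.cast_natCast] at this
      exact this
    rw [e]

theorem geomS_double (w : E r) (a : ℤ) :
    geomS F r 1 w (2 * a) =
      geomS F r 1 ((2 : ℝ) • w) a + X F r w * geomS F r 1 ((2 : ℝ) • w) a := by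
  have step : ∀ a : ℤ, geomS F r 1 w (2 * (a + 1)) = geomS F r 1 w (2 * a)
      + (X F r ((a : ℝ) • (2 : ℝ) • w) + X F r w * X F r ((a : ℝ) • (2 : ℝ) • w)) := by
    intro a
    rw [show 2 * (a + 1) = (2 * a + 1) + 1 by ring, geomS_succ, geomS_succ, X_mul, add_assoc]
    congr 3
    · push_cast; module
    · push_cast; module
  induction a using Int.induction_on with
  | zero => simp [geomS_zero]
  | succ n ih => rw [step, ih, geomS_succ, mul_add]; abel
  | pred n ih =>
    have h1 := step (-(n : ℤ) - 1)
    have h2 := geomS_succ (F := F) ((2 : ℝ) • w) (-(n : ℤ) - 1)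
    rw [sub_add_cancel] at h1 h2
    rw [h1, h2, mul_add] at ih
    rw [← sub_eq_zero] at ih ⊢
    rw [← ih]; abel

theorem floor_split (x : ℝ) :
    (∃ a : ℤ, ⌊x⌋ = 2 * a ∧ floorE x = 2 * a ∧ floorO x = 2 * a - 1) ∨
    (∃ a : ℤ, ⌊x⌋ = 2 * a + 1 ∧ floorE x = 2 * a ∧ floorO x = 2 * a + 1) := by
  have h1 := Int.floor_le x
  have h2 := Int.lt_floor_add_one x
  rcases Int.even_or_odd' ⌊x⌋ with ⟨a, ha | ha⟩
  · left
    rw [ha] at h1 h2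
    push_cast at h1 h2
    refine ⟨a, ha, ?_, ?_⟩
    · rw [floorE, show ⌊x / 2⌋ = a from Int.floor_eq_iff.2 ⟨by linarith, by linarith⟩]
    · rw [floorO, show ⌊(x + 1) / 2⌋ = a from Int.floor_eq_iff.2 ⟨by linarith, by linarith⟩]
  · right
    rw [ha] at h1 h2
    push_cast at h1 h2
    refine ⟨a, ha, ?_, ?_⟩
    · rw [floorE, show ⌊x / 2⌋ = a from Int.floor_eq_iff.2 ⟨by linarith, by linarith⟩]
    · rw [floorO, show ⌊(x + 1) / 2⌋ = a + 1 from
        Int.floor_eq_iff.2 ⟨by push_cast; linarith, by push_cast; linarith⟩]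
      ring

theorem geomS_floor (w : E r) (x : ℝ) :
    geomS F r 1 w (-⌊x⌋) = geomS F r 1 ((2 : ℝ) • w) (-floorE x / 2) +
      X F r w * geomS F r 1 ((2 : ℝ) • w) ((-floorO x - 1) / 2) := by
  rcases floor_split x with ⟨a, h1, h2, h3⟩ | ⟨a, h1, h2, h3⟩
  · rw [h1, h2, h3, show -(2 * a) / 2 = -a by omega, show (-(2 * a - 1) - 1) / 2 = -a by omega,
      show -(2 * a) = 2 * (-a) by ring, geomS_double]
  · rw [h1, h2, h3, show -(2 * a) / 2 = -a by omega,
      show (-(2 * a + 1) - 1) / 2 = -a - 1 by omega]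
    have e1 := geomS_succ (F := F) w (-(2 * a + 1))
    rw [show -(2 * a + 1) + 1 = 2 * (-a) by ring, geomS_double] at e1
    have e2 := geomS_succ (F := F) ((2 : ℝ) • w) (-a - 1)
    rw [sub_add_cancel] at e2
    nth_rewrite 2 [e2] at e1
    rw [mul_add, X_mul] at e1
    rw [show w + ((-a - 1 : ℤ) : ℝ) • (2 : ℝ) • w = ((-(2 * a + 1) : ℤ) : ℝ) • w by
      push_cast; module] at e1
    rw [← add_assoc] at e1
    exact (add_right_cancel e1).symm

theorem chi_sum (k : F) (x : ℝ) : k ^ chiE x * k ^ chiO x = k ^ chiZ x := by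
  rw [← pow_add]
  congr 1
  unfold chiE chiO chiZ
  by_cases h : ∃ n : ℤ, x = n
  · obtain ⟨n, rfl⟩ := h
    rw [if_pos (c := ∃ m : ℤ, (n : ℝ) = m) ⟨n, rfl⟩]
    rcases Int.even_or_odd' n with ⟨a, ha | ha⟩
    · rw [if_pos ⟨a, by rw [ha]; push_cast; ring⟩, if_neg]
      rintro ⟨b, hb⟩
      have : n = 2 * b + 1 := by exact_mod_cast hb
      omega
    · rw [if_pos (c := ∃ m : ℤ, (n : ℝ) = 2 * m + 1) ⟨a, by rw [ha]; push_cast; ring⟩, if_neg]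
      rintro ⟨b, hb⟩
      have : n = 2 * b := by exact_mod_cast hb
      omega
  · rw [if_neg h, if_neg, if_neg]
    · rintro ⟨b, hb⟩; exact h ⟨2 * b + 1, by rw [hb]; push_cast; ring⟩
    · rintro ⟨b, hb⟩; exact h ⟨2 * b, by rw [hb]; push_cast; ring⟩

theorem chiE_neg (x : ℝ) : chiE (-x) = chiE x := by
  unfold chiE
  congr 1
  apply propext
  constructor
  · rintro ⟨n, h⟩; exact ⟨-n, by push_cast; linarith⟩
  · rintro ⟨n, h⟩; exact ⟨-n, by push_cast; linarith⟩

theorem chiO_neg (x : ℝ) : chiO (-x) = chiO x := by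
  unfold chiO
  congr 1
  apply propext
  constructor
  · rintro ⟨n, h⟩; exact ⟨-n - 1, by push_cast; linarith⟩
  · rintro ⟨n, h⟩; exact ⟨-n - 1, by push_cast; linarith⟩

/-- Data attached to a root `v = κ μ` with coroot `μ` and reflection `R`. -/
structure RL (v : E r) (κ : ℤ) (μ : Fin r → ℤ) (R : AW r) : Prop where
  hκ : κ = 1 ∨ κ = 2
  hμ : κ * iz μ μ = 2
  hv : v = (κ : ℝ) • zc r μ
  hR : R.lin = R
  hact : ∀ y, R.act y = y - ip r v y • zc r μ

namespace RL

variable {v : E r} {κ : ℤ} {μ : Fin r → ℤ} {R : AW r}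

theorem ipvv (h : RL v κ μ R) : ip r v v = 2 * κ := by
  have e : ip r v v = (κ : ℝ) * ((κ * iz μ μ : ℤ) : ℝ) := by
    conv_lhs => rw [h.hv]
    rw [ip_smul_left]
    congr 1
    rw [ip]
    simp only [mul_comm (zc r μ _)]
    rw [← ip, ip_smul_left, ip_zc]
    push_cast; ring
  rw [e, h.hμ]; push_cast; ring

theorem co (h : RL v κ μ R) : coroot r v = zc r μ := by
  rw [coroot, h.ipvv]
  conv_lhs => rw [h.hv]
  rw [smul_smul]
  rcases h.hκ with k | k <;> rw [k] <;> norm_num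

theorem refl (h : RL v κ μ R) (y : E r) : sRefl r v y = R.act y := by
  rw [sRefl, h.co, h.hact]

theorem lz (h : RL v κ μ R) (a : Fin r → ℤ) : R.lz a = a + (-(κ * iz μ a)) • μ := by
  apply zc_inj
  rw [← lin_zc, h.hR, h.hact, zc_add, zc_smul]
  conv_lhs => rw [h.hv, ip_smul_left, ip_zc]
  push_cast
  module

theorem lz_self (h : RL v κ μ R) : R.lz μ = (-1 : ℤ) • μ := by
  rw [h.lz, h.hμ]; module

theorem invol (h : RL v κ μ R) (a : Fin r → ℤ) : R.lz (R.lz a) = a := by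
  have h1 : iz μ (R.lz a) = - iz μ a := by
    have := iz_lz R μ a
    rw [h.lz_self, iz_smul_left] at this
    linarith
  rw [h.lz (R.lz a), h1]
  conv_lhs => rw [h.lz a]
  module

theorem invol_act (h : RL v κ μ R) (y : E r) : R.act (R.act y) = y := by
  have h1 : ip r v (R.act y) = - ip r v y := by
    have := ip_lin R v y
    rw [h.hR] at this
    have e : R.act v = (-1 : ℝ) • v := by
      rw [h.hv, ← h.hR, lin_smul, lin_zc, h.lz_self, zc_smul]
      push_cast; module
    rw [e, ip_smul_left] at this
    linarith
  rw [h.hact (R.act y), h1, h.hact y]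
  module

theorem qsc2 (h : RL v κ μ R) (qh : Fˣ) (n : ℤ) :
    qsc F r qh v n * qsc F r qh v n = (qh * qh) ^ (n * iz μ μ) := by
  have hμ := h.hμ
  rw [qsc, h.ipvv]
  rcases h.hκ with k | k
  · rw [k] at hμ ⊢
    rw [if_neg (by norm_num), ← zpow_add]
    congr 1
    rw [one_mul] at hμ
    rw [hμ]; ring
  · rw [k] at hμ ⊢
    rw [if_pos (by norm_num), ← mul_zpow]
    congr 1
    rw [show iz μ μ = 1 by omega, mul_one]

theorem map (h : RL v κ μ R) (w : AW r) :
    RL (w.lin.act v) κ (w.lz μ) (w.lin.comp (R.comp w.lin.inv)) where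
  hκ := h.hκ
  hμ := by rw [iz_lz]; exact h.hμ
  hv := by
    conv_lhs => rw [h.hv]
    rw [lin_smul, lin_zc]
  hR := by
    rw [← h.hR]
    simp only [AW.lin, AW.comp, AW.inv, AW.mk.injEq, true_and]
    funext m
    simp
  hact y := by
    rw [AW.act_comp, AW.act_comp, h.hact, lin_sub, lin_smul, lin_zc, AW.act_inv]
    rw [← ip_lin w v, AW.act_inv]

end RL

theorem ip_eV (a : Fin r) (y : E r) : ip r (eV r a) y = y a := by
  simp [ip, eV]

theorem ip_add_left (u v y : E r) : ip r (u + v) y = ip r u y + ip r v y := by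
  simp [ip, add_mul, Finset.sum_add_distrib]

theorem ip_sub_left (u v y : E r) : ip r (u - v) y = ip r u y - ip r v y := by
  simp [ip, sub_mul, Finset.sum_sub_distrib]

/-- integral basis vector -/
def eZ (a : Fin r) : Fin r → ℤ := fun n => if n = a then 1 else 0

theorem zc_eZ (a : Fin r) : zc r (eZ a) = eV r a := by
  funext m; simp [zc, eZ, eV]

theorem iz_eZ (a : Fin r) (b : Fin r → ℤ) : iz (eZ a) b = b a := by
  simp [iz, eZ]

theorem RL_long (a : Fin r) : RL ((2 : ℝ) • eV r a) 2 (eZ a) (ngA a) where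
  hκ := Or.inr rfl
  hμ := by rw [iz_eZ]; simp [eZ]
  hv := by rw [zc_eZ]; norm_num
  hR := rfl
  hact y := by
    rw [ngA_act, ip_smul_left, ip_eV, zc_eZ]
    funext m
    by_cases h : m = a
    · subst h; simp [eV]; ring
    · simp [h, eV]

theorem RL_sub (a b : Fin r) (hab : a ≠ b) :
    RL (eV r a - eV r b) 1 (eZ a + (-1 : ℤ) • eZ b) (swA a b) where
  hκ := Or.inl rfl
  hμ := by
    simp only [iz, eZ, Pi.add_apply, Pi.smul_apply, add_mul, Finset.sum_add_distrib]
    simp [hab, hab.symm]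
  hv := by rw [zc_add, zc_smul, zc_eZ, zc_eZ]; push_cast; module
  hR := rfl
  hact y := by
    rw [swA_act, ip_sub_left, ip_eV, ip_eV, zc_add, zc_smul, zc_eZ, zc_eZ]
    funext m
    by_cases h : m = a
    · subst h; simp [eV, hab]
    · by_cases h' : m = b
      · subst h'; simp [eV, hab.symm]
      · simp [h, h', eV, Equiv.swap_apply_of_ne_of_ne h h']

theorem RL_add (a b : Fin r) (hab : a ≠ b) :
    RL (eV r a + eV r b) 1 (eZ a + eZ b) (nsA a b) where
  hκ := Or.inl rfl
  hμ := by
    simp only [iz, eZ, Pi.add_apply, add_mul, Finset.sum_add_distrib]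
    simp [hab, hab.symm]
  hv := by rw [zc_add, zc_eZ, zc_eZ]; push_cast; module
  hR := rfl
  hact y := by
    rw [ip_add_left, ip_eV, ip_eV, zc_add, zc_eZ, zc_eZ]
    funext m
    by_cases h : m = a
    · subst h; simp [eV, hab, nsA, AW.act]
    · by_cases h' : m = b
      · subst h'; simp [eV, hab.symm, nsA, AW.act]
      · simp [h, h', eV, Equiv.swap_apply_of_ne_of_ne h h', nsA, AW.act]

theorem RL.neg {v : E r} {κ : ℤ} {μ : Fin r → ℤ} {R : AW r} (h : RL v κ μ R) :
    RL (-v) κ ((-1 : ℤ) • μ) R where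
  hκ := h.hκ
  hμ := by rw [iz_smul_left, iz_smul_right]; linarith [h.hμ]
  hv := by
    conv_lhs => rw [h.hv]
    rw [zc_smul]; push_cast; module
  hR := h.hR
  hact y := by
    rw [h.hact, zc_smul, show -v = (-1 : ℝ) • v by module, ip_smul_left]
    push_cast; module

theorem RL_of_root (v : E r) (hv : v ∈ Phi0 r) : ∃ κ μ R, RL v κ μ R := by
  have hp : ∀ v ∈ PhiPlus r, ∃ κ μ R, RL v κ μ R := by
    rintro v (⟨a, b, hab, rfl⟩ | ⟨a, b, hab, rfl⟩ | ⟨a, rfl⟩)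
    · exact ⟨_, _, _, RL_sub a b hab.ne⟩
    · exact ⟨_, _, _, RL_add a b hab.ne⟩
    · exact ⟨_, _, _, RL_long a⟩
  rcases hv with h | h
  · exact hp v h
  · obtain ⟨κ, μ, R, h'⟩ := hp _ h
    have := h'.neg
    rw [neg_neg] at this
    exact ⟨_, _, _, this⟩



/-! ### Auxiliary material: twisted operators -/

/-- An operator which is multiplicative up to a twist. -/
structure Tw (qh : Fˣ) (O : Set (E r)) (A : Module.End F (QA F r))
    (φ : (Fin r → ℤ) → ℤ) (ρ : (Fin r → ℤ) → (Fin r → ℤ)) : Prop where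
  mem : ∀ y ∈ O, ∀ a, y + zc r a ∈ O
  hφ : ∀ (n : ℤ) a, φ (n • a) = n * φ a
  hρ : ∀ (n : ℤ) a, ρ (n • a) = n • ρ a
  shift : ∀ y ∈ O, ∀ a, A (X F r (y + zc r a)) =
    (((qh * qh) ^ (φ a) : Fˣ) : F) • (X F r (zc r (ρ a)) * A (X F r y))

theorem Tw.geom {qh : Fˣ} {O : Set (E r)} {A : Module.End F (QA F r)}
    {φ : (Fin r → ℤ) → ℤ} {ρ : (Fin r → ℤ) → (Fin r → ℤ)} (h : Tw qh O A φ ρ)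
    (y : E r) (hy : y ∈ O) (a : Fin r → ℤ) (e : ℤ) (c : F) (m : ℤ) :
    A (geomS F r c ((e : ℝ) • zc r a) m * X F r y) =
      geomS F r (c * (((qh * qh) ^ (e * φ a) : Fˣ) : F)) ((e : ℝ) • zc r (ρ a)) m
        * A (X F r y) := by
  apply op_geom
  intro n
  rw [smul_smul, smul_smul, X_mul, add_comm, ← Int.cast_mul, ← zc_smul, ← zc_smul,
    h.shift y hy, h.hφ, h.hρ]
  congr 1
  rw [← Units.val_zpow_eq_zpow_val, ← zpow_mul]
  congr 2
  ring

theorem Tw.combo {qh : Fˣ} {O : Set (E r)} {A : Module.End F (QA F r)}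
    {φ : (Fin r → ℤ) → ℤ} {ρ : (Fin r → ℤ) → (Fin r → ℤ)} (h : Tw qh O A φ ρ)
    (y : E r) (hy : y ∈ O) (a : Fin r → ℤ) (e e' : ℤ) (K K' b c : F) (m m' : ℤ) :
    A ((K • geomS F r c ((e : ℝ) • zc r a) m
        + K' • (b • X F r ((e' : ℝ) • zc r a) * geomS F r c ((e : ℝ) • zc r a) m')) * X F r y) =
      (K • geomS F r (c * (((qh * qh) ^ (e * φ a) : Fˣ) : F)) ((e : ℝ) • zc r (ρ a)) m
        + K' • ((b * (((qh * qh) ^ (e' * φ a) : Fˣ) : F)) • X F r ((e' : ℝ) • zc r (ρ a)) *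
          geomS F r (c * (((qh * qh) ^ (e * φ a) : Fˣ) : F)) ((e : ℝ) • zc r (ρ a)) m'))
        * A (X F r y) := by
  have e1 : (K • geomS F r c ((e : ℝ) • zc r a) m
        + K' • (b • X F r ((e' : ℝ) • zc r a) * geomS F r c ((e : ℝ) • zc r a) m')) * X F r y
      = K • (geomS F r c ((e : ℝ) • zc r a) m * X F r y)
        + (K' * b) • (geomS F r c ((e : ℝ) • zc r a) m' * X F r (y + zc r (e' • a))) := by
    rw [add_mul, ← X_mul, zc_smul, smul_mul_assoc]
    congr 1
    rw [smul_mul_assoc, smul_mul_assoc, smul_mul_assoc, smul_smul]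
    congr 1
    ring
  rw [e1, map_add, map_smul, map_smul, h.geom y hy, h.geom _ (h.mem y hy _), h.shift y hy,
    h.hφ, h.hρ, zc_smul, add_mul, smul_mul_assoc]
  congr 1
  rw [smul_mul_assoc, smul_mul_assoc, smul_mul_assoc, mul_smul_comm, smul_smul, smul_smul]
  congr 1
  · ring
  · ring

section Ops

variable {qh : Fˣ} {O : Set (E r)} {t : Fin r → Fˣ}

theorem saTel_RL {v : E r} {κ : ℤ} {μ : Fin r → ℤ} {R : AW r} (h : RL v κ μ R) (n : ℤ) (y : E r) :
    saTel F r qh t v n y =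
      ((upow F r (torusAct F r qh (gfun r y) t) ((-n) • μ) : Fˣ) : F) • X F r (R.act y) := by
  rw [saTel, h.co, ← zc_smul, upowR_zc, h.refl]

theorem tau_add
    (hE : Equiv' qh O (fun y => torusAct F r qh (gfun r y) t))
    (y : E r) (hy : y ∈ O) (a b : Fin r → ℤ) :
    upow F r (torusAct F r qh (gfun r (y + zc r a)) t) b =
      (qh * qh) ^ iz a b * upow F r (torusAct F r qh (gfun r y) t) b := by
  have := hE.eqv y hy (AW.tr a)
  rw [tr_act] at this
  rw [this, upow_tr]

theorem tau_lin
    (hE : Equiv' qh O (fun y => torusAct F r qh (gfun r y) t))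
    (y : E r) (hy : y ∈ O) (w : AW r) (b : Fin r → ℤ) :
    upow F r (torusAct F r qh (gfun r (w.lin.act y)) t) (w.lz b) =
      upow F r (torusAct F r qh (gfun r y) t) b := by
  have := hE.eqv y hy w.lin
  rw [this, upow_lin]

theorem add_mem
    (hE : Equiv' qh O (fun y => torusAct F r qh (gfun r y) t))
    (y : E r) (hy : y ∈ O) (a : Fin r → ℤ) : y + zc r a ∈ O := by
  rw [← tr_act]; exact hE.mem y hy _

theorem Tw_Sa
    (hE : Equiv' qh O (fun y => torusAct F r qh (gfun r y) t))
    {v : E r} {κ : ℤ} {μ : Fin r → ℤ} {R : AW r} (h : RL v κ μ R) (n : ℤ) :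
    Tw qh O (SaOp F r qh t v n) (fun a => -n * iz a μ) R.lz where
  mem := add_mem hE
  hφ m a := by rw [iz_smul_left]; ring
  hρ m a := lz_smul R m a
  shift y hy a := by
    rw [SaOp, mkOp_X, mkOp_X, saTel_RL h, saTel_RL h, tau_add hE y hy]
    rw [mul_smul_comm, smul_smul, X_mul, Units.val_mul, iz_smul_right]
    congr 2
    conv_lhs => rw [← h.hR]
    rw [lin_add, lin_zc, h.hR, add_comm]

theorem Sa_refl
    (hE : Equiv' qh O (fun y => torusAct F r qh (gfun r y) t))
    {v : E r} {κ : ℤ} {μ : Fin r → ℤ} {R : AW r} (h : RL v κ μ R) (n : ℤ)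
    (y : E r) (hy : y ∈ O) :
    SaOp F r qh t v n (saTel F r qh t v n y) = X F r y := by
  have e : ∀ a : F, ∀ z, SaOp F r qh t v n (a • X F r z) = a • saTel F r qh t v n z := by
    intro a z
    rw [map_smul, SaOp, mkOp_X]
  rw [saTel_RL h, e, saTel_RL h, h.invol_act, smul_smul, ← Units.val_mul]
  have h1 := tau_lin hE y hy R (n • μ)
  rw [lz_smul, h.lz_self, h.hR] at h1
  rw [show (-n) • μ = n • (-1 : ℤ) • μ by module, h1, ← upow_add]
  rw [show n • (-1 : ℤ) • μ + n • μ = 0 by module]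
  simp [upow]

/-- Part (1) in uniform form. -/
theorem part1_core
    (hE : Equiv' qh O (fun y => torusAct F r qh (gfun r y) t))
    {v : E r} {κ : ℤ} {μ : Fin r → ℤ} {R : AW r} (h : RL v κ μ R) (n : ℤ)
    (k0 u0 k kr ur : Fˣ) (y : E r) (hy : y ∈ O) :
    Gel F r qh k0 u0 k kr ur t v n y = SaOp F r qh t v n
      ((((kaf F r k0 k kr v n : Fˣ) : F) ^ chiE (ip r v y) *
        ((khaf F r u0 k ur v n : Fˣ) : F) ^ chiO (ip r v y)) • saTel F r qh t v n y
      + ((((kaf F r k0 k kr v n : Fˣ) : F) - ((kaf F r k0 k kr v n : Fˣ) : F)⁻¹) •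
          geomS F r (((qsc F r qh v n) * (qsc F r qh v n) : Fˣ) : F)
            (((2 : ℤ) : ℝ) • zc r μ) (-floorE (ip r v y) / 2)
        + (((khaf F r u0 k ur v n : Fˣ) : F) - ((khaf F r u0 k ur v n : Fˣ) : F)⁻¹) •
          (((qsc F r qh v n : Fˣ) : F) • X F r (((1 : ℤ) : ℝ) • zc r μ) *
            geomS F r (((qsc F r qh v n) * (qsc F r qh v n) : Fˣ) : F)
              (((2 : ℤ) : ℝ) • zc r μ) (-(floorO (ip r v y) + 1) / 2))) * X F r y) := by
  rw [map_add, (Tw_Sa hE h n).combo y hy, map_smul, Sa_refl hE h n y hy, Gel, SaOp, mkOp_X, h.co]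
  have q2 := h.qsc2 qh n
  have c1 : ((qsc F r qh v n * qsc F r qh v n : Fˣ) : F) *
      (((qh * qh) ^ (2 * (-n * iz μ μ)) : Fˣ) : F)
      = (((qsc F r qh v n)⁻¹ * (qsc F r qh v n)⁻¹ : Fˣ) : F) := by
    rw [← Units.val_mul]
    congr 1
    rw [← mul_inv, q2, ← zpow_add, ← zpow_neg]
    congr 1; ring
  have c2 : ((qsc F r qh v n : Fˣ) : F) * (((qh * qh) ^ (1 * (-n * iz μ μ)) : Fˣ) : F)
      = (((qsc F r qh v n)⁻¹ : Fˣ) : F) := by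
    rw [← Units.val_mul]
    congr 1
    rw [eq_inv_iff_mul_eq_one, mul_right_comm, q2, ← zpow_add]
    rw [show n * iz μ μ + 1 * (-n * iz μ μ) = 0 by ring, zpow_zero]
  rw [c1, c2, h.lz_self, zc_smul]
  have v1 : ((2 : ℤ) : ℝ) • ((-1 : ℤ) : ℝ) • zc r μ = (-2 : ℝ) • zc r μ := by
    push_cast; module
  have v2 : ((1 : ℤ) : ℝ) • ((-1 : ℤ) : ℝ) • zc r μ = (-1 : ℝ) • zc r μ := by
    push_cast; module
  rw [v1, v2]

theorem Wtw_X (w : AW r) (y : E r) :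
    Wtw F r qh t w.act (X F r y) =
      (((upow F r (torusAct F r qh (gfun r (w.lin.act y)) t) w.lam)⁻¹ : Fˣ) : F) •
        X F r (w.lin.act y) := by
  rw [Wtw, mkOp_X, AW.act_sub, AW.act_zero, upowR_zc]

theorem Tw_W
    (hE : Equiv' qh O (fun y => torusAct F r qh (gfun r y) t))
    (w : AW r) : Tw qh O (Wtw F r qh t w.act) (fun a => -iz (w.lz a) w.lam) w.lz where
  mem := add_mem hE
  hφ m a := by rw [lz_smul, iz_smul_left]; ring
  hρ m a := lz_smul w m a
  shift y hy a := by
    rw [Wtw_X, Wtw_X, lin_add, lin_zc, tau_add hE _ (hE.mem y hy _)]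
    rw [mul_smul_comm, smul_smul, X_mul, add_comm, ← Units.val_mul]
    congr 2
    rw [zpow_neg, mul_inv]

theorem Wtw_sa
    (hE : Equiv' qh O (fun y => torusAct F r qh (gfun r y) t))
    {v : E r} {κ : ℤ} {μ : Fin r → ℤ} {R : AW r} (h : RL v κ μ R) (n : ℤ)
    (w : AW r) (y : E r) (hy : y ∈ O) :
    Wtw F r qh t w.act (saTel F r qh t v n y) =
      (((upow F r (torusAct F r qh (gfun r (w.lin.act y)) t) w.lam)⁻¹ : Fˣ) : F) •
        saTel F r qh t (w.lin.act v) (n - κ * iz (w.lz μ) w.lam) (w.lin.act y) := by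
  have h' := h.map w
  rw [saTel_RL h, saTel_RL h', map_smul, Wtw_X, smul_smul, smul_smul]
  set R' := w.lin.comp (R.comp w.lin.inv) with hR'
  have e1 : R'.act (w.lin.act y) = w.lin.act (R.act y) := by
    rw [hR', AW.act_comp, AW.act_comp, AW.inv_act]
  have hy' : w.lin.act y ∈ O := hE.mem y hy _
  rw [e1, ← Units.val_mul, ← Units.val_mul]
  congr 2
  rw [← tau_lin hE y hy w, ← e1]
  have e2 := tau_lin hE _ hy' R' (R'.lz w.lam)
  rw [h'.invol, h'.hR] at e2
  rw [e2, lz_smul]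
  set T := torusAct F r qh (gfun r (w.lin.act y)) t
  have neg : ∀ a, (upow F r T a)⁻¹ = upow F r T ((-1 : ℤ) • a) := by
    intro a; rw [upow_smul]; simp
  rw [neg, neg, ← upow_add, ← upow_add, h'.lz]
  congr 1
  module

/-- Part (2) on monomials. -/
theorem part2_core
    (hE : Equiv' qh O (fun y => torusAct F r qh (gfun r y) t))
    {v : E r} {κ : ℤ} {μ : Fin r → ℤ} {R : AW r} (h : RL v κ μ R) (n : ℤ)
    (k0 u0 k kr ur : Fˣ) (w : AW r) (y : E r) (hy : y ∈ O) :
    Gop F r qh k0 u0 k kr ur t (w.lin.act v) (n - ⌊ip r (w.lin.act v) (zc r w.lam)⌋)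
        (Wtw F r qh t w.act (X F r y)) =
      Wtw F r qh t w.act (Gop F r qh k0 u0 k kr ur t v n (X F r y)) := by
  have h' := h.map w
  have hfl : ⌊ip r (w.lin.act v) (zc r w.lam)⌋ = κ * iz (w.lz μ) w.lam := by
    conv_lhs => rw [h'.hv, ip_smul_left, ip_zc]
    rw [← Int.cast_mul, Int.floor_intCast]
  rw [hfl, Wtw_X, map_smul, Gop, Gop, mkOp_X, mkOp_X]
  set N := n - κ * iz (w.lz μ) w.lam with hN
  have hk : kaf F r k0 k kr (w.lin.act v) N = kaf F r k0 k kr v n ∧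
      khaf F r u0 k ur (w.lin.act v) N = khaf F r u0 k ur v n := by
    unfold kaf khaf
    rw [ip_lin, h.ipvv]
    rcases h.hκ with k1 | k1
    · rw [k1]
      rw [if_neg (by norm_num), if_neg (by norm_num), if_neg (by norm_num), if_neg (by norm_num)]
      exact ⟨rfl, rfl⟩
    · have : Even N ↔ Even n := by
        rw [hN, k1, Int.even_sub]
        simp
      simp only [this, and_self]
  have hq : ∀ e : ℤ, e = -1 → (qsc F r qh v n)⁻¹ * (qh * qh) ^ (e * -iz (w.lz μ) w.lam)
      = (qsc F r qh (w.lin.act v) N)⁻¹ := by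
    intro e he
    unfold qsc
    rw [ip_lin, h.ipvv, he, hN]
    rcases h.hκ with k1 | k1
    · rw [k1, if_neg (by norm_num), if_neg (by norm_num), ← zpow_neg, ← zpow_neg, ← zpow_add]
      congr 1; ring
    · rw [k1, if_pos (by norm_num), if_pos (by norm_num), ← zpow_neg, ← zpow_neg]
      rw [← pow_two, ← zpow_natCast, ← zpow_mul, ← zpow_add]
      congr 1; push_cast; ring
  have hq2 : (qsc F r qh v n)⁻¹ * (qsc F r qh v n)⁻¹ *
      (qh * qh) ^ ((-2 : ℤ) * -iz (w.lz μ) w.lam)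
      = (qsc F r qh (w.lin.act v) N)⁻¹ * (qsc F r qh (w.lin.act v) N)⁻¹ := by
    rw [← hq (-1) rfl, show (-2 : ℤ) * -iz (w.lz μ) w.lam
      = (-1) * -iz (w.lz μ) w.lam + (-1) * -iz (w.lz μ) w.lam by ring, zpow_add]
    exact mul_mul_mul_comm _ _ _ _
  have hsa := Wtw_sa hE h n w y hy
  rw [← hN] at hsa
  rw [Gel, Gel, hk.1, hk.2, ip_lin, map_add, map_smul, Wtw_X, smul_add]
  congr 1
  · exact smul_comm _ _ _
  rw [← mul_smul_comm, ← hsa]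
  rw [saTel_RL h, mul_smul_comm, map_smul, map_smul, mul_smul_comm, h.co, h'.co]
  congr 1
  have hc := (Tw_W hE w).combo (R.act y) (hE.mem y hy R) μ (-2) (-1)
    (((kaf F r k0 k kr v n : Fˣ) : F) - ((kaf F r k0 k kr v n : Fˣ) : F)⁻¹)
    (((khaf F r u0 k ur v n : Fˣ) : F) - ((khaf F r u0 k ur v n : Fˣ) : F)⁻¹)
    (((qsc F r qh v n)⁻¹ : Fˣ) : F)
    (((qsc F r qh v n)⁻¹ * (qsc F r qh v n)⁻¹ : Fˣ) : F)
    (-floorE (ip r v y) / 2) (-(floorO (ip r v y) + 1) / 2)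
  rw [← Units.val_mul, ← Units.val_mul, hq2, hq (-1) rfl] at hc
  rw [show ((-2 : ℤ) : ℝ) = -2 by norm_num, show ((-1 : ℤ) : ℝ) = -1 by norm_num] at hc
  exact hc.symm

theorem FO_ext (O : Set (E r)) (A B : Module.End F (QA F r))
    (h : ∀ y ∈ O, A (X F r y) = B (X F r y)) (f : QA F r) (hf : f ∈ FO F r O) : A f = B f := by
  induction hf using Submodule.span_induction with
  | mem x hx => obtain ⟨y, hy, rfl⟩ := hx; exact h y hy
  | zero => simp
  | add x y _ _ hx hy => rw [map_add, map_add, hx, hy]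
  | smul a x _ hx => rw [map_smul, map_smul, hx]

theorem abar_cases (hr : 2 ≤ r) (j : ℕ) (hj : j ≤ r) :
    (∃ a : Fin r, (a : ℕ) = 0 ∧ j = 0 ∧ abarR r j = -((2 : ℝ) • eV r a)) ∨
    (∃ a : Fin r, (a : ℕ) + 1 = r ∧ j = r ∧ abarR r j = (2 : ℝ) • eV r a) ∨
    (∃ a b : Fin r, (b : ℕ) = a + 1 ∧ j = a + 1 ∧ abarR r j = eV r a - eV r b) := by
  rcases gen_cases hr j hj with ⟨a, ha, hj, -⟩ | ⟨a, ha, hj, -⟩ | ⟨a, b, hab, hj, -⟩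
  · left
    refine ⟨a, ha, hj, ?_⟩
    funext m
    simp only [abarR, abarI, hj, if_true, Pi.neg_apply, Pi.smul_apply, eV, Fin.ext_iff, ha]
    split_ifs <;> simp
  · right; left
    refine ⟨a, ha, hj, ?_⟩
    funext m
    have : (m : ℕ) + 1 = r ↔ m = a := by rw [Fin.ext_iff]; omega
    simp only [abarR, abarI, hj, if_true, Pi.smul_apply, eV, this]
    rw [if_neg (by omega)]
    split_ifs <;> simp
  · right; right
    refine ⟨a, b, hab, hj, ?_⟩
    have hb := b.2
    funext m
    have h1 : (m : ℕ) + 1 = a + 1 ↔ m = a := by rw [Fin.ext_iff]; omega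
    have h2 : (m : ℕ) = a + 1 ↔ m = b := by rw [Fin.ext_iff]; omega
    simp only [abarR, abarI, hj, Pi.sub_apply, eV, h1, h2]
    rw [if_neg (by omega), if_neg (by omega)]
    by_cases h3 : m = a
    · have : m ≠ b := by rw [Ne, Fin.ext_iff]; rw [Fin.ext_iff] at h3; omega
      have h4 : a ≠ b := h3 ▸ this
      simp [h3, h4]
    · by_cases h4 : m = b <;> simp [h3, h4]
      have : b ≠ a := h4 ▸ h3
      simp [this]

theorem part1_X
    (hE : Equiv' qh O (fun y => torusAct F r qh (gfun r y) t))
    (hr : 2 ≤ r) (k0 u0 k kr ur : Fˣ) (j : ℕ) (hj : j ≤ r) (y : E r) (hy : y ∈ O) :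
    Gop F r qh k0 u0 k kr ur t (abarR r j) (if j = 0 then 1 else 0) (X F r y)
        = SaOp F r qh t (abarR r j) (if j = 0 then 1 else 0)
            (Tfull F r qh (k0 : F) (u0 : F) (k : F) (kr : F) (ur : F) t j (X F r y)) := by
  rw [Gop, mkOp_X]
  rcases abar_cases hr j hj with ⟨a, ha, hj, hv⟩ | ⟨a, ha, hj, hv⟩ | ⟨a, b, hab, hj, hv⟩
  · rw [hv]
    have h := (RL_long a).neg
    rw [part1_core hE h _ k0 u0 k kr ur y hy]
    congr 1
    have e4 : ip r (-((2 : ℝ) • eV r a)) (-((2 : ℝ) • eV r a)) = 4 := by rw [h.ipvv]; norm_num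
    have cdy : cd r y 1 = y a := by rw [← cd_succ y a, ha]
    have ep : epsV r 1 = eV r a := by rw [← epsV_succ a, ha]
    have ipy : ip r (-((2 : ℝ) • eV r a)) y = -2 * y a := by
      rw [← neg_smul, ip_smul_left, ip_eV]
    have sE : (ngA a).act y = sEps1 r y := by
      rw [ngA_act]
      funext m
      by_cases h : m = a
      · subst h; simp [sEps1, ha]
      · have : ¬ (m : ℕ) = 0 := by rw [Fin.ext_iff] at h; omega
        simp [h, sEps1, this]
    have up : ∀ T : Fin r → Fˣ, upow F r T ((-1 : ℤ) • (-1 : ℤ) • eZ a) = tcU F r T 1 := by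
      intro T
      have := tcU_succ T a
      rw [ha] at this
      rw [this, upow_smul, upow_smul]
      simp only [upow, eZ]
      rw [Finset.prod_eq_single a]
      · simp
      · intro b _ hb; simp [hb]
      · simp
    simp only [hj, if_true, Tfull, T0op, mkOp_X, T0el, nabla0eEl, nabla0oEl]
    rw [saTel_RL h, up, sE, cdy, ep, ipy, kaf, khaf, qsc, if_pos e4, if_pos e4, if_pos e4,
      if_neg (by decide), if_neg (by decide), zpow_one, zc_smul, zc_eZ, Units.val_mul]
    have v1 : ((2 : ℤ) : ℝ) • ((-1 : ℤ) : ℝ) • eV r a = (-2 : ℝ) • eV r a := by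
      push_cast; module
    have v2 : ((1 : ℤ) : ℝ) • ((-1 : ℤ) : ℝ) • eV r a = (-1 : ℝ) • eV r a := by
      push_cast; module
    rw [v1, v2, add_mul, smul_smul, smul_mul_assoc, smul_mul_assoc, add_assoc,
      show -2 * y a = -(2 * y a) by ring, chiE_neg, chiO_neg, neg_add']
  · rw [hv]
    have h := RL_long a
    rw [part1_core hE h _ k0 u0 k kr ur y hy]
    congr 1
    have e4 : ip r ((2 : ℝ) • eV r a) ((2 : ℝ) • eV r a) = 4 := by rw [h.ipvv]; norm_num
    have cdy : cd r y r = y a := by have := cd_succ y a; rwa [ha] at this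
    have ep : epsV r r = eV r a := by have := epsV_succ a; rwa [ha] at this
    have ipy : ip r ((2 : ℝ) • eV r a) y = 2 * y a := by
      rw [ip_smul_left, ip_eV]
    have sE : (ngA a).act y = sW r r y := by rw [ngA_act, sW_neg y a ha]
    have hj0 : ¬ j = 0 := by omega
    simp only [hj0, if_false, Tfull, Top, mkOp_X, Tel, nablaReEl, nablaRoEl]
    rw [if_pos hj]
    rw [saTel_RL h, sE, cdy, ep, ipy, kaf, khaf, qsc, if_pos e4, if_pos e4, if_pos e4,
      if_pos (by decide), if_pos (by decide), zpow_zero, zc_eZ]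
    simp only [Int.cast_ofNat, Int.cast_one, one_smul, mul_one, Units.val_one, neg_zero, zero_smul]
    rw [show upow F r (torusAct F r qh (gfun r y) t) 0 = 1 by simp [upow]]
    rw [Units.val_one, one_smul, add_mul, smul_mul_assoc, smul_mul_assoc, add_assoc, neg_add']
  · rw [hv]
    have hne : a ≠ b := by rw [Ne, Fin.ext_iff]; omega
    have h := RL_sub a b hne
    have hb := b.2
    rw [part1_core hE h _ k0 u0 k kr ur y hy]
    congr 1
    have e4 : ¬ ip r (eV r a - eV r b) (eV r a - eV r b) = 4 := by rw [h.ipvv]; norm_num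
    have ipy : ip r (eV r a - eV r b) y = y a - y b := by
      rw [ip_sub_left, ip_eV, ip_eV]
    have hj0 : ¬ j = 0 := by omega
    have hjr : ¬ j = r := by omega
    have zm : zc r (eZ a + (-1 : ℤ) • eZ b) = eV r a - eV r b := by
      rw [zc_add, zc_smul, zc_eZ, zc_eZ]; push_cast; module
    simp only [hj0, if_false, Tfull, Top, mkOp_X, Tel, nablaIel]
    rw [if_neg hjr, hj, ← hab, cd_succ, epsV_succ, hab, cd_succ, epsV_succ, sW_swap y a b hab,
      ← swA_act]
    rw [saTel_RL h, ipy, kaf, khaf, qsc, if_neg e4, if_neg e4, if_neg e4, zpow_zero, zm, chi_sum,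
      geomS_floor]
    simp only [Int.cast_ofNat, Int.cast_one, one_smul, mul_one, Units.val_one, neg_zero, zero_smul]
    rw [show upow F r (torusAct F r qh (gfun r y) t) 0 = 1 by simp [upow]]
    rw [Units.val_one, one_smul, ← smul_add, smul_mul_assoc, neg_add']

end Ops


end Aux

/-- (1) `G_t^𝒪(a_j) = s_{a_j,t} ∘ T_j^𝒪` on `F[𝒪]` for the simple
affine roots `a₀ = (-2ε₁, 1)`, `a_i = (ε_i - ε_{i+1}, 0)`, `a_r = (2ε_r, 0)`;
(2) `G_t^𝒪(ga) = g_t ∘ G_t^𝒪(a) ∘ g_t⁻¹` for `g ∈ W` and affine roots `a`. -/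
theorem statement16 (F : Type*) [Field F] [CharZero F] (r : ℕ) (hr : 2 ≤ r)
    (qh k0 u0 k kr ur : Fˣ) (O : Set (E r)) (hO : IsOrbit r O)
    (t : Fin r → Fˣ) (ht : t ∈ TOset F r qh O) :
    (∀ j : ℕ, j ≤ r → ∀ f ∈ FO F r O,
      Gop F r qh k0 u0 k kr ur t (abarR r j) (if j = 0 then 1 else 0) f
        = SaOp F r qh t (abarR r j) (if j = 0 then 1 else 0)
            (Tfull F r qh (k0 : F) (u0 : F) (k : F) (kr : F) (ur : F) t j f)) ∧
    (∀ g, IsWfun r g → ∀ v ∈ Phi0 r, ∀ n : ℤ, ∀ f ∈ FO F r O,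
      Gop F r qh k0 u0 k kr ur t (g v - g 0) (n - ⌊ip r (g v - g 0) (g 0)⌋)
          (Wtw F r qh t g f)
        = Wtw F r qh t g (Gop F r qh k0 u0 k kr ur t v n f)) := by
  obtain ⟨O', hOO, hE⟩ := exists_equiv hr qh O hO t ht
  refine ⟨fun j hj f hf => ?_, fun g hg v hv n f hf => ?_⟩
  · exact FO_ext O _ ((SaOp F r qh t (abarR r j) (if j = 0 then 1 else 0)) ∘ₗ
      (Tfull F r qh (k0 : F) (u0 : F) (k : F) (kr : F) (ur : F) t j))
      (fun y hy => part1_X hE hr k0 u0 k kr ur j hj y (hOO hy)) f hf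
  · obtain ⟨l, hl, rfl⟩ := hg
    obtain ⟨w, hw⟩ := word_AW hr l hl
    obtain ⟨κ, μ, R, h⟩ := RL_of_root v hv
    have hw' : (fun y => wordAct r l y) = w.act := funext hw
    rw [hw', AW.act_sub, AW.act_zero]
    exact FO_ext O (Gop F r qh k0 u0 k kr ur t (w.lin.act v)
        (n - ⌊ip r (w.lin.act v) (zc r w.lam)⌋) ∘ₗ Wtw F r qh t w.act)
      (Wtw F r qh t w.act ∘ₗ Gop F r qh k0 u0 k kr ur t v n)
      (fun y hy => part2_core hE h n k0 u0 k kr ur w y (hOO hy)) f hf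

end QP

end
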